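/- arXiv:2507.22552 — 4 statements merged into one kernel-verified Lean document; each statement's English description precedes it below -/
import Mathlib

section
/- Let d ≥ 1, 0 < α < d and 1 < r < d/α. Then there exists a constant C = C(r,α,d) > 0 such that for every u ∈ ℓ^r(ℤ^d) the series (R_α∗u)(x) = ∑_{y∈ℤ^d} R_α(x,y)u(y) converges absolutely for every x ∈ ℤ^d, and ‖R_α∗u‖_{dr/(d−αr)} ≤ C‖u‖_r. -/
open MeasureTheory Filter Topology
open scoped ENNReal

noncomputable section

namespace DiscreteChoquard

variable {d : ℕ}

/-- The lattice `ℤ^d`. -/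
abbrev Z (d : ℕ) := Fin d → ℤ

/-- Graph distance on `ℤ^d`, as a real number. -/
def latDist (x y : Z d) : ℝ := ∑ i, |((x i - y i : ℤ) : ℝ)|

/-- The kernel hypotheses on `W_s`: symmetry, positivity, and the two-sided bound
`c|x−y|^{−d−2s} ≤ W_s(x,y) ≤ C|x−y|^{−d−2s}` for `x ≠ y`. -/
def KernelOK (d : ℕ) (s : ℝ) (W : Z d → Z d → ℝ) : Prop :=
  (∀ x y, W x y = W y x) ∧ (∀ x y, 0 < W x y) ∧
  ∃ c C : ℝ, 0 < c ∧ c ≤ C ∧ ∀ x y : Z d, x ≠ y →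
    c * latDist x y ^ (-(d : ℝ) - 2 * s) ≤ W x y ∧
      W x y ≤ C * latDist x y ^ (-(d : ℝ) - 2 * s)

/-- The fractional gradient form `∇^s u ∇^s v (x)`.  (The `y = x` summand vanishes, so we
sum over all `y`.) -/
def gradForm (W : Z d → Z d → ℝ) (u v : Z d → ℝ) (x : Z d) : ℝ :=
  (1 / 2) * ∑' y : Z d, W x y * (u x - u y) * (v x - v y)

/-- `|∇^s u|(x)`. -/
def gradNorm (W : Z d → Z d → ℝ) (u : Z d → ℝ) (x : Z d) : ℝ :=
  Real.sqrt ((1 / 2) * ∑' y : Z d, W x y * (u x - u y) ^ 2)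

/-- The fractional `p`-Laplacian `(−Δ)_p^s u (x)`. -/
def pLap (W : Z d → Z d → ℝ) (p : ℝ) (u : Z d → ℝ) (x : Z d) : ℝ :=
  (1 / 2) * ∑' y : Z d,
    W x y * (gradNorm W u x ^ (p - 2) + gradNorm W u y ^ (p - 2)) * (u x - u y)

/-- `‖u‖_{H_{s,p}}^p = ∑_x (|∇^s u|^p(x) + h(x)|u(x)|^p)`. -/
def HnormP (W : Z d → Z d → ℝ) (h : Z d → ℝ) (p : ℝ) (u : Z d → ℝ) : ℝ :=
  ∑' x : Z d, (gradNorm W u x ^ p + h x * |u x| ^ p)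

/-- `‖u‖_{H_{s,p}}`. -/
def normH (W : Z d → Z d → ℝ) (h : Z d → ℝ) (p : ℝ) (u : Z d → ℝ) : ℝ :=
  HnormP W h p u ^ (1 / p)

/-- Membership `u ∈ H_{s,p}`, i.e. `‖u‖_{H_{s,p}} < ∞` (all the defining series converge). -/
def memH (W : Z d → Z d → ℝ) (h : Z d → ℝ) (p : ℝ) (u : Z d → ℝ) : Prop :=
  (∀ x : Z d, Summable fun y : Z d => W x y * (u x - u y) ^ 2) ∧
  Summable fun x : Z d => gradNorm W u x ^ p + h x * |u x| ^ p

/-- The `ℓ^q` norm on `ℤ^d`. -/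
def lnorm (q : ℝ) (u : Z d → ℝ) : ℝ := (∑' x : Z d, |u x| ^ q) ^ (1 / q)

/-- The torus box `[0, 2π]^d`. -/
def box (d : ℕ) : Set (Fin d → ℝ) := Set.univ.pi fun _ => Set.Icc 0 (2 * Real.pi)

/-- `μ(k) = 2d − 2 ∑_j cos k_j`. -/
def muk (d : ℕ) (k : Fin d → ℝ) : ℝ := 2 * d - 2 * ∑ j, Real.cos (k j)

/-- The fractional degree `K_α = (2π)^{-d} ∫_{[0,2π]^d} μ(k)^{α/2} dk`. -/
def Kfrac (d : ℕ) (α : ℝ) : ℝ :=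
  (2 * Real.pi) ^ (-(d : ℝ)) * ∫ k in box d, muk d k ^ (α / 2)

/-- The Green's function `R_α(x,y)` of the discrete fractional Laplacian. -/
def Riesz (d : ℕ) (α : ℝ) (x y : Z d) : ℝ :=
  Kfrac d α * (2 * Real.pi) ^ (-(d : ℝ)) *
    ∫ k in box d, Real.cos (∑ j, ((x j - y j : ℤ) : ℝ) * k j) * muk d k ^ (-(α / 2))

/-- The convolution `(R_α ∗ v)(x) = ∑_y R_α(x,y) v(y)`. -/
def conv (d : ℕ) (α : ℝ) (v : Z d → ℝ) (x : Z d) : ℝ := ∑' y : Z d, Riesz d α x y * v y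

/-- `F(t) = ∫_0^t f(r) dr`. -/
def Fint (f : ℝ → ℝ) (t : ℝ) : ℝ := ∫ r in (0 : ℝ)..t, f r

/-- Positive part `u⁺ = max(u,0)`. -/
def pos (u : Z d → ℝ) (x : Z d) : ℝ := max (u x) 0

/-- Negative part `u⁻ = min(u,0)`. -/
def negp (u : Z d → ℝ) (x : Z d) : ℝ := min (u x) 0

/-- Hypothesis (h2): `h(x) → ∞` as `|x| → ∞`. -/
def H2 (h : Z d → ℝ) : Prop := Tendsto h cofinite atTop

/-- Hypothesis (f1): `f(t) = o(t^{p−1})` as `t → 0⁺`. -/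
def F1 (f : ℝ → ℝ) (p : ℝ) : Prop :=
  ∀ ε > (0 : ℝ), ∃ δ > (0 : ℝ), ∀ t : ℝ, 0 < t → t < δ → |f t| ≤ ε * t ^ (p - 1)

/-- Hypothesis (f3): `0 ≤ θ F(t) ≤ 2 f(t) t` for `t > 0`. -/
def F3 (f : ℝ → ℝ) (θ : ℝ) : Prop :=
  ∀ t > (0 : ℝ), 0 ≤ θ * Fint f t ∧ θ * Fint f t ≤ 2 * f t * t

/-- The energy functional `J̃`. -/
def energy (W : Z d → Z d → ℝ) (h : Z d → ℝ) (p α : ℝ) (f : ℝ → ℝ) (u : Z d → ℝ) : ℝ :=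
  (1 / p) * HnormP W h p u -
    (1 / 2) * ∑' x : Z d, conv d α (fun y => Fint f (pos u y)) x * Fint f (pos u x)

/-- The Nehari set `M`. -/
def Nehari (W : Z d → Z d → ℝ) (h : Z d → ℝ) (p α : ℝ) (f : ℝ → ℝ) : Set (Z d → ℝ) :=
  {u | memH W h p u ∧ u ≠ 0 ∧
    HnormP W h p u =
      ∑' x : Z d, conv d α (fun y => Fint f (pos u y)) x * f (pos u x) * pos u x}

/-- Hypothesis (f4). -/
def F4 (W : Z d → Z d → ℝ) (h : Z d → ℝ) (p α : ℝ) (f : ℝ → ℝ) : Prop :=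
  ∀ u : Z d → ℝ, memH W h p u → pos u ≠ 0 →
    StrictMonoOn (fun t : ℝ =>
      t ^ (1 - p) *
        ∑' x : Z d, conv d α (fun y => Fint f (t * pos u y)) x * f (t * pos u x) * pos u x)
      (Set.Ioi 0)

/-- The derivative pairing `⟨J̃′(u), φ⟩`. -/
def pairing (W : Z d → Z d → ℝ) (h : Z d → ℝ) (p α : ℝ) (f : ℝ → ℝ) (u φ : Z d → ℝ) : ℝ :=
  (∑' x : Z d,
      (gradNorm W u x ^ (p - 2) * gradForm W u φ x + h x * |u x| ^ (p - 2) * u x * φ x)) -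
    ∑' x : Z d, conv d α (fun y => Fint f (pos u y)) x * f (pos u x) * φ x

/-- `max (1, |n|)`. -/
def rho (n : ℤ) : ℝ := max 1 |(n : ℝ)|

lemma one_le_rho (n : ℤ) : 1 ≤ rho n := le_max_left _ _

lemma rho_pos (n : ℤ) : 0 < rho n := lt_of_lt_of_le one_pos (one_le_rho n)

/-- sums over `ℤ` of a function of `rho` are controlled by sums over `ℕ`. -/
lemma tsum_rho_le (g : ℝ → ℝ≥0∞) :
    ∑' n : ℤ, g (rho n) ≤ 4 * ∑' n : ℕ, g ((n : ℝ) + 1) := by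
  have h1 : ∑' n : ℕ, g (rho (n : ℤ)) ≤ 2 * ∑' n : ℕ, g ((n : ℝ) + 1) := by
    rw [tsum_eq_zero_add' ENNReal.summable, two_mul]
    refine add_le_add ?_ ?_
    · have : g (rho ((0 : ℕ) : ℤ)) = g (((0 : ℕ) : ℝ) + 1) := by simp [rho]
      rw [this]
      exact ENNReal.le_tsum (f := fun n : ℕ => g ((n : ℝ) + 1)) 0
    · refine ENNReal.tsum_le_tsum fun n => ?_
      have : rho ((n + 1 : ℕ) : ℤ) = (n : ℝ) + 1 := by
        unfold rho
        push_cast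
        rw [abs_of_nonneg (by positivity)]
        apply max_eq_right
        linarith [Nat.cast_nonneg (α := ℝ) n]
      rw [this]
  have h2 : ∑' n : ℕ, g (rho (-((n : ℤ) + 1))) ≤ 2 * ∑' n : ℕ, g ((n : ℝ) + 1) := by
    rw [two_mul]
    refine le_trans (le_of_eq ?_) le_self_add
    congr 1
    ext n
    have : rho (-((n : ℤ) + 1)) = (n : ℝ) + 1 := by
      unfold rho
      push_cast
      rw [abs_neg, abs_of_nonneg (by positivity)]
      apply max_eq_right
      linarith [Nat.cast_nonneg (α := ℝ) n]
    rw [this]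
  have h3 : ∑' n : ℤ, g (rho n) = ∑' n : ℕ, g (rho (n : ℤ)) + ∑' n : ℕ, g (rho (-((n : ℤ) + 1))) :=
    tsum_of_nat_of_neg_add_one (f := fun n : ℤ => g (rho n)) ENNReal.summable ENNReal.summable
  rw [h3]
  calc _ ≤ _ := add_le_add h1 h2
    _ = _ := by ring

lemma head_step {γ : ℝ} (h0 : 0 < γ) (h1 : γ < 1) (n : ℕ) :
    ((n : ℝ) + 1) ^ (γ - 1) ≤ (((n : ℝ) + 1) ^ γ - (n : ℝ) ^ γ) / γ := by
  have hn : (0 : ℝ) < (n : ℝ) + 1 := by positivity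
  have hb := rpow_one_add_le_one_add_mul_self (s := -1 / ((n : ℝ) + 1))
    (by rw [le_div_iff₀ hn]; linarith [Nat.cast_nonneg (α := ℝ) n]) h0.le h1.le
  have e1 : 1 + -1 / ((n : ℝ) + 1) = n / ((n : ℝ) + 1) := by field_simp; ring
  rw [e1, Real.div_rpow (by positivity) hn.le, div_le_iff₀ (by positivity)] at hb
  rw [le_div_iff₀ h0, Real.rpow_sub_one hn.ne']
  have : (1 + γ * (-1 / ((n : ℝ) + 1))) * ((n : ℝ) + 1) ^ γ
    = ((n : ℝ) + 1) ^ γ - ((n : ℝ) + 1) ^ γ / ((n : ℝ) + 1) * γ := by ring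
  linarith

lemma head_sum {γ : ℝ} (h0 : 0 < γ) (h1 : γ < 1) (N : ℕ) :
    ∑ n ∈ Finset.range N, ((n : ℝ) + 1) ^ (γ - 1) ≤ (N : ℝ) ^ γ / γ := by
  induction N with
  | zero => simp [Real.zero_rpow h0.ne']
  | succ k ih =>
    rw [Finset.sum_range_succ]
    have := head_step h0 h1 k
    rw [sub_div] at this
    push_cast
    linarith

lemma tail_step {δ : ℝ} (h0 : 0 < δ) (n : ℝ) (hn0 : 0 < n) :
    (n + 1) ^ (-(δ + 1)) ≤ (n ^ (-δ) - (n + 1) ^ (-δ)) / δ := by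
  have hn : (0 : ℝ) < n + 1 := by positivity
  have hl : Real.log (n / (n + 1)) ≤ - (1 / (n + 1)) := by
    have := Real.log_le_sub_one_of_pos (x := n / (n + 1)) (by positivity)
    have e : n / (n + 1) - 1 = - (1 / (n + 1)) := by field_simp; ring
    linarith
  have hb : 1 + δ * (1 / (n + 1)) ≤ (n / (n + 1)) ^ (-δ) := by
    rw [Real.rpow_def_of_pos (by positivity)]
    refine le_trans ?_ (Real.add_one_le_exp _)
    nlinarith
  rw [Real.div_rpow hn0.le hn.le, le_div_iff₀ (by positivity)] at hb
  have e2 : (n + 1) ^ (-(δ + 1)) = (n + 1) ^ (-δ) / (n + 1) := by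
    rw [← Real.rpow_sub_one hn.ne']; congr 1; ring
  rw [le_div_iff₀ h0, e2]
  have : (1 + δ * (1 / (n + 1))) * (n + 1) ^ (-δ) =
    (n + 1) ^ (-δ) + (n + 1) ^ (-δ) / (n + 1) * δ := by ring
  linarith

lemma tail_sum {δ : ℝ} (h0 : 0 < δ) (x : ℝ) (hx : 0 < x) (N : ℕ) :
    ∑ n ∈ Finset.range N, (x + n + 1) ^ (-(δ + 1)) ≤ (x ^ (-δ) - (x + N) ^ (-δ)) / δ := by
  induction N with
  | zero => simp
  | succ k ih =>
    rw [Finset.sum_range_succ]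
    have := tail_step h0 (x + k) (by positivity)
    rw [sub_div] at this ih ⊢
    push_cast
    rw [← add_assoc]
    linarith

lemma sum_head {γ : ℝ} (h0 : 0 < γ) (h1 : γ < 1) : ∃ C : ℝ, 0 < C ∧ ∀ R : ℝ, 1 ≤ R →
    ∑' n : ℤ, (if rho n ≤ R then ENNReal.ofReal (rho n ^ (γ - 1)) else 0)
      ≤ ENNReal.ofReal (C * R ^ γ) := by
  refine ⟨4 / γ, by positivity, fun R hR => ?_⟩
  refine (tsum_rho_le (fun t => if t ≤ R then ENNReal.ofReal (t ^ (γ - 1)) else 0)).trans ?_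
  have : ∑' n : ℕ, (if (n : ℝ) + 1 ≤ R then ENNReal.ofReal (((n : ℝ) + 1) ^ (γ - 1)) else 0)
      ≤ ENNReal.ofReal (R ^ γ / γ) := by
    rw [tsum_eq_sum (s := Finset.range ⌊R⌋₊)]
    · calc _ ≤ ∑ n ∈ Finset.range ⌊R⌋₊, ENNReal.ofReal (((n : ℝ) + 1) ^ (γ - 1)) := by
            apply Finset.sum_le_sum
            intro i _
            split_ifs
            · exact le_rfl
            · exact zero_le
        _ = ENNReal.ofReal (∑ n ∈ Finset.range ⌊R⌋₊, ((n : ℝ) + 1) ^ (γ - 1)) := by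
            rw [ENNReal.ofReal_sum_of_nonneg]
            intros; positivity
        _ ≤ _ := by
            apply ENNReal.ofReal_le_ofReal
            refine (head_sum h0 h1 _).trans ?_
            gcongr
            exact Nat.floor_le (by linarith)
    · intro n hn
      rw [if_neg]
      intro h
      apply hn
      rw [Finset.mem_range]
      have : n + 1 ≤ ⌊R⌋₊ := Nat.le_floor (by push_cast; exact h)
      omega
  calc _ ≤ 4 * ENNReal.ofReal (R ^ γ / γ) := by gcongr
    _ = ENNReal.ofReal (4 * (R ^ γ / γ)) := by
      rw [ENNReal.ofReal_mul (by norm_num)]; simp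
    _ = _ := by congr 1; ring

lemma sum_tail {β : ℝ} (h1 : 1 < β) : ∃ C : ℝ, 0 < C ∧ ∀ R : ℝ, 1 ≤ R →
    ∑' n : ℤ, (if R < rho n then ENNReal.ofReal (rho n ^ (-β)) else 0)
      ≤ ENNReal.ofReal (C * R ^ (1 - β)) := by
  have hδ : 0 < β - 1 := by linarith
  refine ⟨4 * 2 ^ (β - 1) / (β - 1), by positivity, fun R hR => ?_⟩
  refine (tsum_rho_le (fun t => if R < t then ENNReal.ofReal (t ^ (-β)) else 0)).trans ?_
  have hN : 1 ≤ ⌊R⌋₊ := Nat.le_floor (by simpa using hR)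
  have hN' : R / 2 ≤ (⌊R⌋₊ : ℝ) := by
    have := Nat.lt_floor_add_one R
    have h2 : (1 : ℝ) ≤ (⌊R⌋₊ : ℝ) := by exact_mod_cast hN
    linarith
  have key : ∑' n : ℕ, (if R < (n : ℝ) + 1 then ENNReal.ofReal (((n : ℝ) + 1) ^ (-β)) else 0)
      ≤ ENNReal.ofReal ((R / 2) ^ (-(β - 1)) / (β - 1)) := by
    rw [← ENNReal.summable.sum_add_tsum_nat_add' (k := ⌊R⌋₊)]
    rw [Finset.sum_eq_zero, zero_add]
    · rw [ENNReal.tsum_eq_iSup_nat]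
      apply iSup_le
      intro M
      calc _ ≤ ∑ n ∈ Finset.range M, ENNReal.ofReal (((⌊R⌋₊ : ℝ) + n + 1) ^ (-((β - 1) + 1))) := by
            apply Finset.sum_le_sum
            intro i _
            split_ifs
            · apply le_of_eq
              congr 2
              · push_cast; ring
              · ring
            · exact zero_le
        _ = ENNReal.ofReal (∑ n ∈ Finset.range M, ((⌊R⌋₊ : ℝ) + n + 1) ^ (-((β - 1) + 1))) := by
            rw [ENNReal.ofReal_sum_of_nonneg]
            intros; positivity
        _ ≤ _ := by
            apply ENNReal.ofReal_le_ofReal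
            refine (tail_sum hδ _ (by positivity) _).trans ?_
            gcongr
            have h3 : (⌊R⌋₊ : ℝ) ^ (-(β - 1)) ≤ (R / 2) ^ (-(β - 1)) :=
              Real.rpow_le_rpow_of_nonpos (by linarith) hN' (by linarith)
            have : 0 ≤ ((⌊R⌋₊ : ℝ) + M) ^ (-(β - 1)) := by positivity
            linarith
    · intro i hi
      rw [if_neg]
      rw [Finset.mem_range] at hi
      have h3 : ((i + 1 : ℕ) : ℝ) ≤ ⌊R⌋₊ := by exact_mod_cast hi
      have := Nat.floor_le (a := R) (by linarith)
      push_cast at h3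
      linarith
  calc _ ≤ 4 * ENNReal.ofReal ((R / 2) ^ (-(β - 1)) / (β - 1)) := by gcongr
    _ = ENNReal.ofReal (4 * ((R / 2) ^ (-(β - 1)) / (β - 1))) := by
      rw [ENNReal.ofReal_mul (by norm_num)]; simp
    _ = _ := by
      congr 1
      rw [Real.div_rpow (by linarith) (by norm_num), Real.rpow_neg (by norm_num : (0:ℝ) ≤ 2)]
      have : -(β - 1) = 1 - β := by ring
      rw [this]
      field_simp

lemma tsum_holder (g h : ℤ → ℝ≥0∞) {p q : ℝ} (hpq : p.HolderConjugate q) :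
    ∑' y, g y * h y ≤ (∑' y, g y ^ p) ^ (1 / p) * (∑' y, h y ^ q) ^ (1 / q) := by
  have := ENNReal.lintegral_mul_le_Lp_mul_Lq (Measure.count : Measure ℤ) hpq
    (f := g) (g := h) (Measurable.of_discrete.aemeasurable) (Measurable.of_discrete.aemeasurable)
  simpa [lintegral_count] using this

lemma hls_tail {a r q : ℝ} (hr : 1 < r) (hq : 0 < q)
    (hqe : 1 / q = 1 / r - a) : ∃ A : ℝ, 0 < A ∧ ∀ R : ℝ, 1 ≤ R → ∀ f : ℤ → ℝ, (∀ y, 0 ≤ f y) →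
      ∑' y, ENNReal.ofReal (f y ^ r) ≤ 1 → ∀ x : ℤ,
      ∑' y, (if R < rho (x - y) then ENNReal.ofReal (rho (x - y) ^ (a - 1) * f y) else 0)
        ≤ ENNReal.ofReal (A * R ^ (-(1 / q))) := by
  set p := r.conjExponent with hp
  have hpr : p.HolderConjugate r := (Real.HolderConjugate.conjExponent hr).symm
  have hp0 : 0 < p := hpr.pos
  have hpinv : 1 / p = 1 - 1 / r := by
    have := hpr.inv_add_inv_eq_one
    rw [one_div, one_div]; linarith
  have hq0 : 0 < 1 / q := by positivity
  have hβ : 1 < (1 - a) * p := by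
    have h1 : 1 / p < 1 - a := by linarith
    have h2 : 1 / p * p = 1 := by field_simp
    nlinarith
  obtain ⟨C, hC, hT⟩ := sum_tail hβ
  refine ⟨C ^ (1 / p), by positivity, fun R hR f hf hs x => ?_⟩
  set g : ℤ → ℝ≥0∞ := fun y => if R < rho (x - y) then ENNReal.ofReal (rho (x - y) ^ (a - 1)) else 0
  have e1 : ∀ y, (if R < rho (x - y) then ENNReal.ofReal (rho (x - y) ^ (a - 1) * f y) else 0)
      = g y * ENNReal.ofReal (f y) := by
    intro y
    simp only [g]
    split_ifs
    · rw [ENNReal.ofReal_mul (Real.rpow_nonneg (rho_pos _).le _)]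
    · simp
  simp_rw [e1]
  refine (tsum_holder g _ hpr).trans ?_
  have e2 : ∑' y, ENNReal.ofReal (f y) ^ r ≤ 1 := by
    refine le_trans (le_of_eq ?_) hs
    refine tsum_congr fun y => ?_
    rw [ENNReal.ofReal_rpow_of_nonneg (hf y) (by linarith)]
  have e3 : ∑' y, g y ^ p ≤ ENNReal.ofReal (C * R ^ (1 - (1 - a) * p)) := by
    refine le_trans (le_of_eq ?_) (hT R hR)
    rw [← (Equiv.subLeft x).tsum_eq (fun n : ℤ =>
      (if R < rho n then ENNReal.ofReal (rho n ^ (-((1 - a) * p))) else 0))]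
    refine tsum_congr fun y => ?_
    simp only [g, Equiv.subLeft_apply]
    split_ifs
    · rw [ENNReal.ofReal_rpow_of_nonneg (Real.rpow_nonneg (rho_pos _).le _) hp0.le,
        ← Real.rpow_mul (rho_pos _).le]
      congr 2; ring
    · exact ENNReal.zero_rpow_of_pos hp0
  calc _ ≤ (ENNReal.ofReal (C * R ^ (1 - (1 - a) * p))) ^ (1 / p) * 1 ^ (1 / r) := by
        gcongr
    _ = _ := by
        rw [ENNReal.one_rpow, mul_one, ENNReal.ofReal_rpow_of_nonneg (by positivity) (by positivity),
          Real.mul_rpow hC.le (by positivity), ← Real.rpow_mul (by linarith)]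
        congr 3
        have : (1 - (1 - a) * p) * (1 / p) = 1 / p - (1 - a) := by field_simp
        rw [this]; linarith

lemma hls_head {a : ℝ} (ha : 0 < a) (ha1 : a < 1) : ∃ H : ℝ, 0 < H ∧ ∀ R : ℝ, 1 ≤ R →
      ∀ s : ℝ, 0 ≤ s → ∀ f : ℤ → ℝ, (∀ y, 0 ≤ f y) → ∀ x : ℤ,
      ∑' y, (if rho (x - y) ≤ R ∧ f y ≤ s then ENNReal.ofReal (rho (x - y) ^ (a - 1) * f y) else 0)
        ≤ ENNReal.ofReal (s * (H * R ^ a)) := by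
  obtain ⟨C, hC, hT⟩ := sum_head ha ha1
  refine ⟨C, hC, fun R hR s hs f hf x => ?_⟩
  rw [ENNReal.ofReal_mul hs]
  refine le_trans ?_ (mul_le_mul_right (hT R hR) _)
  rw [← ENNReal.tsum_mul_left, ← (Equiv.subLeft x).tsum_eq (fun n : ℤ =>
    ENNReal.ofReal s * (if rho n ≤ R then ENNReal.ofReal (rho n ^ (a - 1)) else 0))]
  refine ENNReal.tsum_le_tsum fun y => ?_
  simp only [Equiv.subLeft_apply]
  have := (rho_pos (x - y)).le
  split_ifs with h1 h2 h2
  · rw [← ENNReal.ofReal_mul hs]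
    apply ENNReal.ofReal_le_ofReal
    rw [mul_comm]
    exact mul_le_mul_of_nonneg_right h1.2 (by positivity)
  · exact absurd h1.1 h2
  · exact zero_le
  · exact zero_le

lemma hls_dual {a r q : ℝ} (ha : 0 < a) (ha1 : a < 1) (hr : 1 < r) (hq : 1 < q)
    (hqe : 1 / q = 1 / r - a) : ∃ K : ℝ, 0 < K ∧ ∀ φ : ℝ, 0 ≤ φ → φ ≤ 1 → ∀ y : ℤ,
      ∑' x, ENNReal.ofReal (rho (x - y) ^ (a - 1) * φ *
        min (rho (x - y) ^ (-(1 / q))) (φ ^ (r / q)) ^ (q - 1)) ≤ ENNReal.ofReal (K * φ ^ r) := by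
  obtain ⟨C, hC, hH⟩ := sum_head ha ha1
  have hr0 : 0 < r := by linarith
  have hq0 : 0 < q := by linarith
  have hrinv : 1 / r < 1 := by rw [div_lt_one hr0]; exact hr
  obtain ⟨C', hC', hT⟩ := sum_tail (β := 2 - 1 / r) (by linarith)
  refine ⟨C + C', by positivity, fun φ h0 h1 y => ?_⟩
  rcases h0.eq_or_lt with h0 | h0
  · subst h0
    simp
  set P := φ ^ (-r) with hP
  have hP1 : 1 ≤ P := Real.one_le_rpow_of_pos_of_le_one_of_nonpos h0 h1 (by linarith)
  have key : ∀ x : ℤ, ENNReal.ofReal (rho (x - y) ^ (a - 1) * φ *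
        min (rho (x - y) ^ (-(1 / q))) (φ ^ (r / q)) ^ (q - 1)) ≤
      ENNReal.ofReal (φ * φ ^ (r / q * (q - 1))) *
        (if rho (x - y) ≤ P then ENNReal.ofReal (rho (x - y) ^ (a - 1)) else 0) +
      ENNReal.ofReal φ *
        (if P < rho (x - y) then ENNReal.ofReal (rho (x - y) ^ (-(2 - 1 / r))) else 0) := by
    intro x
    have hρ := rho_pos (x - y)
    set ρ := rho (x - y)
    by_cases h : ρ ≤ P
    · rw [if_pos h, if_neg (not_lt.2 h), mul_zero, add_zero, ← ENNReal.ofReal_mul (by positivity)]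
      apply ENNReal.ofReal_le_ofReal
      have : min (ρ ^ (-(1 / q))) (φ ^ (r / q)) ^ (q - 1) ≤ φ ^ (r / q * (q - 1)) := by
        rw [Real.rpow_mul h0.le]
        exact Real.rpow_le_rpow (by positivity) (min_le_right _ _) (by linarith)
      calc _ ≤ ρ ^ (a - 1) * φ * φ ^ (r / q * (q - 1)) := by gcongr
        _ = _ := by ring
    · rw [if_neg h, if_pos (not_le.1 h), mul_zero, zero_add, ← ENNReal.ofReal_mul (by positivity)]
      apply ENNReal.ofReal_le_ofReal
      have : min (ρ ^ (-(1 / q))) (φ ^ (r / q)) ^ (q - 1) ≤ ρ ^ (-(1 / q) * (q - 1)) := by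
        rw [Real.rpow_mul hρ.le]
        exact Real.rpow_le_rpow (by positivity) (min_le_left _ _) (by linarith)
      calc _ ≤ ρ ^ (a - 1) * φ * ρ ^ (-(1 / q) * (q - 1)) := by gcongr
        _ = φ * (ρ ^ (a - 1) * ρ ^ (-(1 / q) * (q - 1))) := by ring
        _ = _ := by
          rw [← Real.rpow_add hρ]
          congr 2
          have : -(1 / q) * (q - 1) = 1 / q - 1 := by field_simp; ring
          rw [this]; linarith
  have key2 : ∑' x : ℤ, ENNReal.ofReal (rho (x - y) ^ (a - 1) * φ *
        min (rho (x - y) ^ (-(1 / q))) (φ ^ (r / q)) ^ (q - 1)) ≤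
      ENNReal.ofReal (φ * φ ^ (r / q * (q - 1))) * ENNReal.ofReal (C * P ^ a) +
        ENNReal.ofReal φ * ENNReal.ofReal (C' * P ^ (1 - (2 - 1 / r))) := by
    refine (ENNReal.tsum_le_tsum key).trans ?_
    rw [ENNReal.tsum_add, ENNReal.tsum_mul_left, ENNReal.tsum_mul_left]
    refine add_le_add (mul_le_mul_right ?_ _) (mul_le_mul_right ?_ _)
    · refine le_trans (le_of_eq ?_) (hH P hP1)
      exact (Equiv.subRight y).tsum_eq
        (fun n : ℤ => if rho n ≤ P then ENNReal.ofReal (rho n ^ (a - 1)) else 0)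
    · refine le_trans (le_of_eq ?_) (hT P hP1)
      exact (Equiv.subRight y).tsum_eq
        (fun n : ℤ => if P < rho n then ENNReal.ofReal (rho n ^ (-(2 - 1 / r))) else 0)
  refine key2.trans (le_of_eq ?_)
  rw [← ENNReal.ofReal_mul (by positivity), ← ENNReal.ofReal_mul (by positivity),
    ← ENNReal.ofReal_add (by positivity) (by positivity)]
  congr 1
  have e1 : φ * φ ^ (r / q * (q - 1)) * (C * P ^ a) = C * φ ^ r := by
    rw [hP, ← Real.rpow_mul h0.le]
    calc _ = C * (φ ^ (1 : ℝ) * φ ^ (r / q * (q - 1)) * φ ^ (-r * a)) := by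
          rw [Real.rpow_one]; ring
      _ = _ := by
          rw [← Real.rpow_add h0, ← Real.rpow_add h0]
          congr 2
          have : r / q * (q - 1) = r - r * (1 / q) := by field_simp
          rw [this, hqe]; field_simp; ring
  have e2 : φ * (C' * P ^ (1 - (2 - 1 / r))) = C' * φ ^ r := by
    rw [hP, ← Real.rpow_mul h0.le]
    calc _ = C' * (φ ^ (1 : ℝ) * φ ^ (-r * (1 - (2 - 1 / r)))) := by
          rw [Real.rpow_one]; ring
      _ = _ := by
          rw [← Real.rpow_add h0]
          congr 2
          field_simp; ring
  rw [e1, e2]; ring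

lemma hls_pointwise {a r q : ℝ} (ha : 0 < a) (ha1 : a < 1) (hr : 1 < r) (hq : 1 < q)
    (hqe : 1 / q = 1 / r - a) : ∃ D : ℝ, 0 < D ∧ ∀ f : ℤ → ℝ, (∀ y, 0 ≤ f y) → (∀ y, f y ≤ 1) →
      ∑' y, ENNReal.ofReal (f y ^ r) ≤ 1 → ∀ x : ℤ,
      (∑' y, ENNReal.ofReal (rho (x - y) ^ (a - 1) * f y)) ^ q ≤
       ENNReal.ofReal D * ∑' y, ENNReal.ofReal (rho (x - y) ^ (a - 1) * f y *
        min (rho (x - y) ^ (-(1 / q))) (f y ^ (r / q)) ^ (q - 1)) := by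
  have hr0 : 0 < r := by linarith
  have hq0 : 0 < q := by linarith
  obtain ⟨A, hA, hT⟩ := hls_tail (a := a) hr hq0 hqe
  obtain ⟨H, hH, hHd⟩ := hls_head ha ha1
  set B := A + H with hB
  have hB0 : 0 < B := by positivity
  set M := 4 * H * (4 * B) ^ (q * a) with hM
  have hM0 : 0 < M := by positivity
  set D := max (4 * B) (M ^ (r / q)) with hD
  have hD0 : 0 < D := lt_max_of_lt_left (by positivity)
  refine ⟨2 * D ^ (q - 1), by positivity, fun f hf hf1 hs x => ?_⟩
  have split : ∀ R s : ℝ, ∑' y, ENNReal.ofReal (rho (x - y) ^ (a - 1) * f y) =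
      (∑' y, (if R < rho (x - y) then ENNReal.ofReal (rho (x - y) ^ (a - 1) * f y) else 0)) +
      (∑' y, (if rho (x - y) ≤ R ∧ f y ≤ s then
        ENNReal.ofReal (rho (x - y) ^ (a - 1) * f y) else 0)) +
      (∑' y, (if rho (x - y) ≤ R ∧ s < f y then
        ENNReal.ofReal (rho (x - y) ^ (a - 1) * f y) else 0)) := by
    intro R s
    rw [← ENNReal.tsum_add, ← ENNReal.tsum_add]
    refine tsum_congr fun y => ?_
    by_cases h1 : R < rho (x - y)
    · simp [h1, not_le.2 h1]
    · by_cases h2 : s < f y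
      · simp [h1, not_lt.1 h1, h2, not_le.2 h2]
      · simp [h1, not_lt.1 h1, h2, not_lt.1 h2]
  set T := ∑' y, ENNReal.ofReal (rho (x - y) ^ (a - 1) * f y) with hTdef
  have hTB : T ≤ ENNReal.ofReal B := by
    rw [split 1 1, hB, ENNReal.ofReal_add hA.le hH.le]
    have h1 := hT 1 le_rfl f hf hs x
    have h2 := hHd 1 le_rfl 1 zero_le_one f hf x
    simp only [Real.one_rpow, mul_one, one_mul] at h1 h2
    have h3 : (∑' y, (if rho (x - y) ≤ 1 ∧ 1 < f y then
        ENNReal.ofReal (rho (x - y) ^ (a - 1) * f y) else 0)) = 0 := by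
      rw [ENNReal.tsum_eq_zero]
      intro y
      rw [if_neg]
      rintro ⟨_, h⟩
      exact absurd h (not_lt.2 (hf1 y))
    rw [h3, add_zero]
    exact add_le_add h1 h2
  have hTtop : T ≠ ⊤ := ne_top_of_le_ne_top ENNReal.ofReal_ne_top hTB
  set l := T.toReal with hl
  have hTl : T = ENNReal.ofReal l := (ENNReal.ofReal_toReal hTtop).symm
  have hl0 : 0 ≤ l := ENNReal.toReal_nonneg
  rcases hl0.eq_or_lt with h0 | h0
  · rw [hTl, ← h0]
    simp [hq0]
  have hlB : l ≤ B := ENNReal.toReal_le_of_le_ofReal hB0.le hTB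
  set R := (4 * B / l) ^ q with hR
  have hBl : 0 < 4 * B / l := by positivity
  have hR1 : 1 ≤ R := by
    apply Real.one_le_rpow _ hq0.le
    rw [le_div_iff₀ h0]; linarith
  set s := l / (4 * (H * R ^ a)) with hsdef
  have hR0 : 0 < R := by linarith
  have hs0 : 0 < s := by positivity
  have h1 : ∑' y, (if R < rho (x - y) then ENNReal.ofReal (rho (x - y) ^ (a - 1) * f y) else 0)
      ≤ ENNReal.ofReal (l / 4) := by
    refine (hT R hR1 f hf hs x).trans (ENNReal.ofReal_le_ofReal ?_)
    have : R ^ (-(1 / q)) = l / (4 * B) := by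
      rw [hR, ← Real.rpow_mul hBl.le]
      have : q * -(1 / q) = -1 := by field_simp
      rw [this, Real.rpow_neg_one, inv_div]
    rw [this]
    have hAB : A ≤ B := by linarith
    calc A * (l / (4 * B)) ≤ B * (l / (4 * B)) := by gcongr
      _ = l / 4 := by field_simp
  have h2 : ∑' y, (if rho (x - y) ≤ R ∧ f y ≤ s then
      ENNReal.ofReal (rho (x - y) ^ (a - 1) * f y) else 0) ≤ ENNReal.ofReal (l / 4) := by
    refine (hHd R hR1 s hs0.le f hf x).trans (ENNReal.ofReal_le_ofReal (le_of_eq ?_))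
    rw [hsdef]; field_simp
  set G := (∑' y, (if rho (x - y) ≤ R ∧ s < f y then
        ENNReal.ofReal (rho (x - y) ^ (a - 1) * f y) else 0)) with hG
  have h3 : ENNReal.ofReal (l / 2) ≤ G := by
    have h4 : ENNReal.ofReal (l / 2) + ENNReal.ofReal (l / 2) ≤ ENNReal.ofReal (l / 2) + G := by
      calc _ = T := by rw [hTl, ← ENNReal.ofReal_add (by positivity) (by positivity)]; congr 1; ring
        _ ≤ (ENNReal.ofReal (l / 4) + ENNReal.ofReal (l / 4)) + G := by
            rw [split R s]; gcongr
        _ = _ := by rw [← ENNReal.ofReal_add (by positivity) (by positivity)]; congr 2; ring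
    exact (ENNReal.add_le_add_iff_left ENNReal.ofReal_ne_top).1 h4
  have hmin : ∀ y, rho (x - y) ≤ R → s < f y →
      l ≤ D * min (rho (x - y) ^ (-(1 / q))) (f y ^ (r / q)) := by
    intro y hy1 hy2
    have hρ := rho_pos (x - y)
    set ρ := rho (x - y)
    rw [mul_min_of_nonneg _ _ hD0.le]
    apply le_min
    · have h5 : ρ ^ (1 / q) ≤ 4 * B / l := by
        calc ρ ^ (1 / q) ≤ R ^ (1 / q) := by gcongr
          _ = 4 * B / l := by
            rw [hR, ← Real.rpow_mul hBl.le, mul_one_div_cancel hq0.ne', Real.rpow_one]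
      rw [le_div_iff₀ h0] at h5
      rw [Real.rpow_neg hρ.le]
      have h6 : 0 < ρ ^ (1 / q) := by positivity
      calc l = (ρ ^ (1 / q) * l) * (ρ ^ (1 / q))⁻¹ := by field_simp
        _ ≤ (4 * B) * (ρ ^ (1 / q))⁻¹ := by gcongr
        _ ≤ _ := by gcongr; exact le_max_left _ _
    · have hfy : 0 < f y := hs0.trans hy2
      have h5 : l ^ (q / r) ≤ M * f y := by
        have h6 : l ^ (q / r) = M * s := by
          rw [hM, hsdef, hR, ← Real.rpow_mul hBl.le, Real.div_rpow (by positivity) h0.le]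
          have h7 : q / r = 1 + q * a := by
            have : q * (1 / q) = q * (1 / r - a) := by rw [hqe]
            rw [mul_one_div_cancel hq0.ne'] at this
            rw [this]; ring
          rw [h7, Real.rpow_add h0, Real.rpow_one]
          have : 0 < l ^ (q * a) := by positivity
          have : 0 < (4 * B) ^ (q * a) := by positivity
          field_simp
        rw [h6]; gcongr
      calc l = (l ^ (q / r)) ^ (r / q) := by
            rw [← Real.rpow_mul h0.le]
            have : q / r * (r / q) = 1 := by field_simp
            rw [this, Real.rpow_one]
        _ ≤ (M * f y) ^ (r / q) := by gcongr
        _ = M ^ (r / q) * f y ^ (r / q) := Real.mul_rpow hM0.le hfy.le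
        _ ≤ _ := by gcongr; exact le_max_right _ _
  have hlq : T ^ q = ENNReal.ofReal (2 * l ^ (q - 1)) * ENNReal.ofReal (l / 2) := by
    rw [hTl, ENNReal.ofReal_rpow_of_pos h0, ← ENNReal.ofReal_mul (by positivity)]
    congr 1
    rw [Real.rpow_sub_one h0.ne']; field_simp
  rw [hlq]
  calc _ ≤ ENNReal.ofReal (2 * l ^ (q - 1)) * G := by gcongr
    _ ≤ _ := by
      rw [hG, ← ENNReal.tsum_mul_left, ← ENNReal.tsum_mul_left]
      refine ENNReal.tsum_le_tsum fun y => ?_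
      split_ifs with h
      · have hρ := rho_pos (x - y)
        have hfy := hf y
        rw [← ENNReal.ofReal_mul (by positivity), ← ENNReal.ofReal_mul (by positivity)]
        apply ENNReal.ofReal_le_ofReal
        have h5 := hmin y h.1 h.2
        have hm0 : 0 ≤ min (rho (x - y) ^ (-(1 / q))) (f y ^ (r / q)) := by positivity
        set m := min (rho (x - y) ^ (-(1 / q))) (f y ^ (r / q))
        have h6 : l ^ (q - 1) ≤ D ^ (q - 1) * m ^ (q - 1) := by
          rw [← Real.mul_rpow hD0.le hm0]
          exact Real.rpow_le_rpow h0.le h5 (by linarith)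
        calc _ ≤ 2 * (D ^ (q - 1) * m ^ (q - 1)) * (rho (x - y) ^ (a - 1) * f y) := by gcongr
          _ = _ := by ring
      · simp

lemma hls_normalized {a r q : ℝ} (ha : 0 < a) (ha1 : a < 1) (hr : 1 < r) (hq : 1 < q)
    (hqe : 1 / q = 1 / r - a) : ∃ C : ℝ, 0 < C ∧ ∀ f : ℤ → ℝ, (∀ y, 0 ≤ f y) → (∀ y, f y ≤ 1) →
      ∑' y, ENNReal.ofReal (f y ^ r) ≤ 1 →
      ∑' x, (∑' y, ENNReal.ofReal (rho (x - y) ^ (a - 1) * f y)) ^ q ≤ ENNReal.ofReal C := by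
  obtain ⟨D, hD, h1⟩ := hls_pointwise ha ha1 hr hq hqe
  obtain ⟨K, hK, h2⟩ := hls_dual ha ha1 hr hq hqe
  refine ⟨D * K, by positivity, fun f hf hf1 hs => ?_⟩
  refine (ENNReal.tsum_le_tsum (h1 f hf hf1 hs)).trans ?_
  rw [ENNReal.tsum_mul_left, ENNReal.tsum_comm, ENNReal.ofReal_mul hD.le]
  gcongr
  refine (ENNReal.tsum_le_tsum fun y => h2 (f y) (hf y) (hf1 y) y).trans ?_
  simp_rw [ENNReal.ofReal_mul hK.le]
  rw [ENNReal.tsum_mul_left]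
  calc _ ≤ ENNReal.ofReal K * 1 := by gcongr
    _ = _ := mul_one _

/-- the one-dimensional kernel -/
def wker (a : ℝ) (n : ℤ) : ℝ≥0∞ := ENNReal.ofReal (rho n ^ (a - 1))

/-- one-dimensional Hardy–Littlewood–Sobolev. -/
lemma hls_one {a r q : ℝ} (ha : 0 < a) (ha1 : a < 1) (hr : 1 < r) (hq : 1 < q)
    (hqe : 1 / q = 1 / r - a) : ∃ C : ℝ, 0 < C ∧ ∀ f : ℤ → ℝ≥0∞,
      (∑' x, (∑' y, wker a (x - y) * f y) ^ q) ^ (1 / q) ≤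
        ENNReal.ofReal C * (∑' y, f y ^ r) ^ (1 / r) := by
  have hr0 : 0 < r := by linarith
  have hq0 : 0 < q := by linarith
  obtain ⟨C, hC, hN⟩ := hls_normalized ha ha1 hr hq hqe
  refine ⟨C ^ (1 / q), by positivity, fun f => ?_⟩
  have hC0 : 0 < C ^ (1 / q) := by positivity
  set N := (∑' y, f y ^ r) ^ (1 / r) with hNdef
  have hNr : N ^ r = ∑' y, f y ^ r := by
    rw [hNdef, ← ENNReal.rpow_mul, one_div_mul_cancel hr0.ne', ENNReal.rpow_one]
  have hfN : ∀ y, f y ≤ N := by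
    intro y
    rw [← ENNReal.rpow_le_rpow_iff hr0, hNr]
    exact ENNReal.le_tsum y
  by_cases hNt : N = ⊤
  · rw [hNt, ENNReal.mul_top (by simpa using hC0)]
    exact le_top
  by_cases hN0 : N = 0
  · have : ∀ y, f y = 0 := fun y => by have := hfN y; rw [hN0] at this; simpa using this
    simp [this, hq0]
  set g : ℤ → ℝ := fun y => (f y / N).toReal with hg
  have hfNt : ∀ y, f y / N ≠ ⊤ := fun y =>
    ENNReal.div_ne_top (ne_top_of_le_ne_top hNt (hfN y)) hN0
  have hgf : ∀ y, f y = N * ENNReal.ofReal (g y) := by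
    intro y
    rw [hg, ENNReal.ofReal_toReal (hfNt y), ENNReal.mul_div_cancel hN0 hNt]
  have hg0 : ∀ y, 0 ≤ g y := fun y => ENNReal.toReal_nonneg
  have hg1 : ∀ y, g y ≤ 1 := by
    intro y
    apply ENNReal.toReal_le_of_le_ofReal zero_le_one
    rw [ENNReal.ofReal_one]
    exact ENNReal.div_le_of_le_mul (by rw [one_mul]; exact hfN y)
  have hgs : ∑' y, ENNReal.ofReal (g y ^ r) ≤ 1 := by
    have h1 : N ^ r * ∑' y, ENNReal.ofReal (g y ^ r) = N ^ r * 1 := by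
      rw [← ENNReal.tsum_mul_left, mul_one, hNr]
      refine tsum_congr fun y => ?_
      rw [← ENNReal.ofReal_rpow_of_nonneg (hg0 y) hr0.le, ← hNr,
        ← ENNReal.mul_rpow_of_nonneg _ _ hr0.le, ← hgf y]
    have h2 : N ^ r ≠ 0 := by simp [hN0, hNt]
    have h3 : N ^ r ≠ ⊤ := by simp [hNt, hN0]
    exact ((ENNReal.mul_right_inj h2 h3).1 h1).le
  have h := hN g hg0 hg1 hgs
  have e : ∑' x, (∑' y, wker a (x - y) * f y) ^ q =
      N ^ q * ∑' x, (∑' y, ENNReal.ofReal (rho (x - y) ^ (a - 1) * g y)) ^ q := by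
    rw [← ENNReal.tsum_mul_left]
    refine tsum_congr fun x => ?_
    rw [← ENNReal.mul_rpow_of_nonneg _ _ hq0.le, ← ENNReal.tsum_mul_left]
    congr 1
    refine tsum_congr fun y => ?_
    rw [hgf y, wker, ENNReal.ofReal_mul (Real.rpow_nonneg (rho_pos _).le _)]
    ring
  rw [e, ENNReal.mul_rpow_of_nonneg _ _ (by positivity), ← ENNReal.rpow_mul,
    mul_one_div_cancel hq0.ne', ENNReal.rpow_one, mul_comm, ← ENNReal.ofReal_rpow_of_pos hC]
  gcongr

lemma tsum_mink_finset {Y : Type*} {q : ℝ} (hq : 1 ≤ q) (F : ℤ → Y → ℝ≥0∞) (s : Finset ℤ) :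
    (∑' y, (∑ n ∈ s, F n y) ^ q) ^ (1 / q) ≤ ∑ n ∈ s, (∑' y, F n y ^ q) ^ (1 / q) := by
  classical
  let _ : MeasurableSpace Y := ⊤
  have hq0 : 0 < q := by linarith
  induction s using Finset.induction_on with
  | empty => simp [hq0]
  | insert m s hm ih =>
    simp_rw [Finset.sum_insert hm]
    have := ENNReal.lintegral_Lp_add_le (μ := (Measure.count : Measure Y)) (p := q)
      (f := F m) (g := fun y => ∑ n ∈ s, F n y)
      (measurable_from_top.aemeasurable) (measurable_from_top.aemeasurable) hq
    rw [lintegral_count' measurable_from_top, lintegral_count' measurable_from_top,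
      lintegral_count' measurable_from_top] at this
    simp only [Pi.add_apply] at this
    exact this.trans (by gcongr)

lemma tsum_mink {Y : Type*} {q : ℝ} (hq : 1 ≤ q) (F : ℤ → Y → ℝ≥0∞) :
    (∑' y, (∑' n, F n y) ^ q) ^ (1 / q) ≤ ∑' n, (∑' y, F n y ^ q) ^ (1 / q) := by
  have hq0 : 0 < q := by linarith
  set B := ∑' n, (∑' y, F n y ^ q) ^ (1 / q) with hB
  suffices h : ∑' y, (∑' n, F n y) ^ q ≤ B ^ q by
    calc _ ≤ (B ^ q) ^ (1 / q) := by gcongr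
      _ = B := by rw [← ENNReal.rpow_mul, mul_one_div_cancel hq0.ne', ENNReal.rpow_one]
  rw [ENNReal.tsum_eq_iSup_sum]
  refine iSup_le fun S => ?_
  have hlim : Tendsto (fun s : Finset ℤ => ∑ y ∈ S, (∑ n ∈ s, F n y) ^ q) atTop
      (𝓝 (∑ y ∈ S, (∑' n, F n y) ^ q)) := by
    refine tendsto_finsetSum _ fun y _ => ?_
    exact ((ENNReal.continuous_rpow_const (y := q)).tendsto _).comp
      (ENNReal.summable.hasSum : HasSum (fun n => F n y) _)
  refine le_of_tendsto' hlim fun s => ?_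
  calc _ ≤ ∑' y, (∑ n ∈ s, F n y) ^ q := ENNReal.sum_le_tsum S
    _ = ((∑' y, (∑ n ∈ s, F n y) ^ q) ^ (1 / q)) ^ q := by
      rw [← ENNReal.rpow_mul, one_div_mul_cancel hq0.ne', ENNReal.rpow_one]
    _ ≤ _ := by
      gcongr
      exact (tsum_mink_finset hq F s).trans (ENNReal.sum_le_tsum s)

/-- the product kernel -/
def Wker (d : ℕ) (a : ℝ) (z : Fin d → ℤ) : ℝ≥0∞ := ∏ j, wker a (z j)

lemma tsum_cons (d : ℕ) (g : (Fin (d + 1) → ℤ) → ℝ≥0∞) :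
    ∑' x, g x = ∑' x0 : ℤ, ∑' x' : Fin d → ℤ, g (Fin.cons x0 x') := by
  rw [← (Fin.consEquiv (fun _ : Fin (d + 1) => ℤ)).tsum_eq, ENNReal.tsum_prod']
  rfl

lemma hls_prod {a r q : ℝ} (ha : 0 < a) (ha1 : a < 1) (hr : 1 < r) (hq : 1 < q)
    (hqe : 1 / q = 1 / r - a) (d : ℕ) : ∃ C : ℝ, 0 < C ∧ ∀ f : (Fin d → ℤ) → ℝ≥0∞,
      (∑' x, (∑' y, Wker d a (x - y) * f y) ^ q) ^ (1 / q) ≤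
        ENNReal.ofReal C * (∑' y, f y ^ r) ^ (1 / r) := by
  have hr0 : 0 < r := by linarith
  have hq0 : 0 < q := by linarith
  induction d with
  | zero =>
    refine ⟨1, one_pos, fun f => ?_⟩
    rw [tsum_fintype, tsum_fintype]
    simp_rw [tsum_fintype]
    simp only [Wker, Finset.univ_eq_empty, Finset.prod_empty, one_mul, Finset.univ_unique,
      Finset.sum_singleton, ENNReal.ofReal_one]
    rw [← ENNReal.rpow_mul, ← ENNReal.rpow_mul, mul_one_div_cancel hq0.ne',
      mul_one_div_cancel hr0.ne']
  | succ d ih =>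
    obtain ⟨C, hC, h⟩ := ih
    obtain ⟨C1, hC1, h1⟩ := hls_one ha ha1 hr hq hqe
    refine ⟨C * C1, by positivity, fun f => ?_⟩
    set Nf : ℤ → ℝ≥0∞ := fun y0 => (∑' y' : Fin d → ℤ, f (Fin.cons y0 y') ^ r) ^ (1 / r) with hNf
    have hW : ∀ (x0 y0 : ℤ) (x' y' : Fin d → ℤ),
        Wker (d + 1) a ((Fin.cons x0 x' : Fin (d + 1) → ℤ) - (Fin.cons y0 y' : Fin (d + 1) → ℤ)) =
          wker a (x0 - y0) * Wker d a (x' - y') := by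
      intro x0 y0 x' y'
      simp [Wker, Fin.prod_univ_succ]
    have hin : ∀ x0 : ℤ,
        ∑' x' : Fin d → ℤ, (∑' y, Wker (d + 1) a (Fin.cons x0 x' - y) * f y) ^ q ≤
          (ENNReal.ofReal C) ^ q * (∑' y0, wker a (x0 - y0) * Nf y0) ^ q := by
      intro x0
      rw [← ENNReal.mul_rpow_of_nonneg _ _ hq0.le, ← ENNReal.rpow_le_rpow_iff (z := 1 / q)
        (by positivity)]
      rw [← ENNReal.rpow_mul (ENNReal.ofReal C * _), mul_one_div_cancel hq0.ne', ENNReal.rpow_one]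
      simp_rw [tsum_cons d (fun y => Wker (d + 1) a (_ - y) * f y), hW]
      refine (tsum_mink hq.le (fun (y0 : ℤ) (x' : Fin d → ℤ) =>
        ∑' y', wker a (x0 - y0) * Wker d a (x' - y') * f (Fin.cons y0 y'))).trans ?_
      rw [← ENNReal.tsum_mul_left]
      refine ENNReal.tsum_le_tsum fun y0 => ?_
      simp_rw [mul_assoc, ENNReal.tsum_mul_left, ENNReal.mul_rpow_of_nonneg _ _ hq0.le,
        ENNReal.tsum_mul_left]
      rw [ENNReal.mul_rpow_of_nonneg _ _ (by positivity), ← ENNReal.rpow_mul,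
        mul_one_div_cancel hq0.ne', ENNReal.rpow_one, mul_left_comm]
      gcongr
      exact h (fun y' => f (Fin.cons y0 y'))
    rw [tsum_cons]
    calc _ ≤ (∑' x0, (ENNReal.ofReal C) ^ q * (∑' y0, wker a (x0 - y0) * Nf y0) ^ q) ^ (1 / q) := by
          gcongr with x0
          exact hin x0
      _ = ENNReal.ofReal C * (∑' x0, (∑' y0, wker a (x0 - y0) * Nf y0) ^ q) ^ (1 / q) := by
          rw [ENNReal.tsum_mul_left, ENNReal.mul_rpow_of_nonneg _ _ (by positivity),
            ← ENNReal.rpow_mul, mul_one_div_cancel hq0.ne', ENNReal.rpow_one]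
      _ ≤ ENNReal.ofReal C * (ENNReal.ofReal C1 * (∑' y0, Nf y0 ^ r) ^ (1 / r)) := by
          gcongr
          exact h1 Nf
      _ = _ := by
          have e : ∑' y0, Nf y0 ^ r = ∑' y, f y ^ r := by
            rw [tsum_cons d (fun y => f y ^ r)]
            refine tsum_congr fun y0 => ?_
            rw [hNf, ← ENNReal.rpow_mul, one_div_mul_cancel hr0.ne', ENNReal.rpow_one]
          rw [← mul_assoc, ← ENNReal.ofReal_mul hC.le, e]

/-- one-dimensional heat factor -/
def hfac (t k : ℝ) : ℝ := Real.exp (-(t * (2 - 2 * Real.cos k)))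

/-- one-dimensional heat kernel (unnormalised, complex form) -/
def qhat (t : ℝ) (n : ℤ) : ℂ :=
  ∫ k in Set.Icc 0 (2 * Real.pi), Complex.exp ((n : ℂ) * (k : ℂ) * Complex.I) * (hfac t k : ℂ)

lemma hfac_cont (t : ℝ) : Continuous (hfac t) := by unfold hfac; fun_prop

lemma hfac_pos (t k : ℝ) : 0 < hfac t k := Real.exp_pos _

lemma norm_cexp_int (n : ℤ) (k : ℝ) : ‖Complex.exp ((n : ℂ) * (k : ℂ) * Complex.I)‖ = 1 := by
  have : (n : ℂ) * (k : ℂ) = (((n : ℝ) * k : ℝ) : ℂ) := by push_cast; rfl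
  rw [this, Complex.norm_exp_ofReal_mul_I]

lemma qhat_le_integral (t : ℝ) (n : ℤ) :
    ‖qhat t n‖ ≤ ∫ k in Set.Icc 0 (2 * Real.pi), hfac t k := by
  unfold qhat
  refine (norm_integral_le_integral_norm _).trans (le_of_eq ?_)
  congr 1
  ext k
  rw [norm_mul, norm_cexp_int, one_mul, Complex.norm_real, Real.norm_of_nonneg (hfac_pos t k).le]

lemma qhat_le_const {t : ℝ} (ht : 0 ≤ t) (n : ℤ) : ‖qhat t n‖ ≤ 2 * Real.pi := by
  refine (qhat_le_integral t n).trans ?_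
  have hp := Real.pi_pos
  have h : ∫ k in Set.Icc 0 (2 * Real.pi), hfac t k ≤ ∫ k in Set.Icc 0 (2 * Real.pi), (1 : ℝ) := by
    apply setIntegral_mono_on ((hfac_cont t).integrableOn_Icc) (by simp [ENNReal.mul_lt_top]) measurableSet_Icc
    intro k _
    unfold hfac
    rw [Real.exp_le_one_iff]
    have := Real.cos_le_one k
    have : 0 ≤ t * (2 - 2 * Real.cos k) := mul_nonneg ht (by linarith)
    linarith
  refine h.trans (le_of_eq ?_)
  simp [hp.le]

lemma qhat_le_sqrt {t : ℝ} (ht : 0 < t) (n : ℤ) : ‖qhat t n‖ ≤ 6 * Real.pi / Real.sqrt t := by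
  refine (qhat_le_integral t n).trans ?_
  have hp := Real.pi_pos
  set b := 4 * t / Real.pi ^ 2 with hb
  have hb0 : 0 < b := by positivity
  have hi := integrable_exp_neg_mul_sq hb0
  have hi2 : Integrable (fun k : ℝ => Real.exp (-b * (2 * Real.pi - k) ^ 2)) :=
    hi.comp_sub_left (2 * Real.pi)
  have hpt : ∀ k ∈ Set.Icc 0 (2 * Real.pi),
      hfac t k ≤ Real.exp (-b * k ^ 2) + Real.exp (-b * (2 * Real.pi - k) ^ 2) := by
    intro k hk
    have hx : ∀ x : ℝ, |x| ≤ Real.pi → Real.cos x = Real.cos k → hfac t k ≤ Real.exp (-b * x ^ 2) := by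
      intro x hx hc
      unfold hfac
      rw [Real.exp_le_exp]
      have h1 := Real.cos_le_one_sub_mul_cos_sq hx
      rw [hc] at h1
      have h2 : b * x ^ 2 = t * (2 * (2 / Real.pi ^ 2 * x ^ 2)) := by rw [hb]; ring
      have h3 : t * (2 * (2 / Real.pi ^ 2 * x ^ 2)) ≤ t * (2 - 2 * Real.cos k) := by
        apply mul_le_mul_of_nonneg_left _ ht.le
        linarith
      linarith
    rcases le_total k Real.pi with h | h
    · have := hx k (by rw [abs_of_nonneg hk.1]; exact h) rfl
      have := Real.exp_pos (-b * (2 * Real.pi - k) ^ 2)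
      linarith
    · have := hx (2 * Real.pi - k) (by rw [abs_of_nonneg (by linarith [hk.2])]; linarith)
        (Real.cos_two_pi_sub k)
      have := Real.exp_pos (-b * k ^ 2)
      linarith
  have hg : ∫ k : ℝ, Real.exp (-b * k ^ 2) = Real.sqrt (Real.pi / b) := integral_gaussian b
  have hg2 : ∫ k : ℝ, Real.exp (-b * (2 * Real.pi - k) ^ 2) = Real.sqrt (Real.pi / b) := by
    rw [← hg]
    exact integral_sub_left_eq_self (fun k : ℝ => Real.exp (-b * k ^ 2)) volume (2 * Real.pi)
  calc ∫ k in Set.Icc 0 (2 * Real.pi), hfac t k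
      ≤ ∫ k in Set.Icc 0 (2 * Real.pi),
        (Real.exp (-b * k ^ 2) + Real.exp (-b * (2 * Real.pi - k) ^ 2)) :=
        setIntegral_mono_on ((hfac_cont t).integrableOn_Icc) (hi.add hi2).integrableOn
          measurableSet_Icc hpt
    _ ≤ ∫ k, (Real.exp (-b * k ^ 2) + Real.exp (-b * (2 * Real.pi - k) ^ 2)) := by
        apply setIntegral_le_integral (hi.add hi2)
        filter_upwards with k
        exact add_nonneg (Real.exp_pos _).le (Real.exp_pos _).le
    _ = 2 * Real.sqrt (Real.pi / b) := by rw [integral_add hi hi2, hg, hg2]; ring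
    _ ≤ _ := by
        rw [le_div_iff₀ (by positivity), mul_assoc, ← Real.sqrt_mul (by positivity)]
        have e : Real.pi / b * t = Real.pi * (Real.pi / 2) ^ 2 := by
          rw [hb]; field_simp; ring
        rw [e, Real.sqrt_mul hp.le, Real.sqrt_sq (by positivity)]
        have : Real.sqrt Real.pi ≤ 2 := by
          rw [Real.sqrt_le_left (by norm_num)]; linarith [Real.pi_le_four]
        nlinarith

lemma hfac_deriv (t k : ℝ) :
    HasDerivAt (hfac t) (-(2 * t * Real.sin k * hfac t k)) k := by
  unfold hfac
  have h := ((((Real.hasDerivAt_cos k).const_mul 2).const_sub 2).const_mul t).neg.exp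
  refine HasDerivAt.congr_deriv h ?_
  simp only [Pi.neg_apply]
  ring

lemma qhat_le_inv {t : ℝ} (ht : 0 < t) (n : ℤ) (hn : n ≠ 0) : ‖qhat t n‖ ≤ 2 / |(n : ℝ)| := by
  have hp := Real.pi_pos
  have hnC : (n : ℂ) * Complex.I ≠ 0 := mul_ne_zero (by exact_mod_cast hn) Complex.I_ne_zero
  set v : ℝ → ℂ := fun k => Complex.exp ((n : ℂ) * (k : ℂ) * Complex.I) / ((n : ℂ) * Complex.I)
  set v' : ℝ → ℂ := fun k => Complex.exp ((n : ℂ) * (k : ℂ) * Complex.I)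
  set g' : ℝ → ℝ := fun k => -(2 * t * Real.sin k * hfac t k) with hg'
  have hg'c : Continuous g' := by
    have := hfac_cont t
    simp only [hg']; fun_prop
  have hv : ∀ k, HasDerivAt v (v' k) k := by
    intro k
    have h1 : HasDerivAt (fun k : ℝ => (k : ℂ)) 1 k := Complex.ofRealCLM.hasDerivAt
    have h2 := (((h1.const_mul (n : ℂ)).mul_const Complex.I).cexp).div_const ((n : ℂ) * Complex.I)
    refine HasDerivAt.congr_deriv h2 ?_
    simp only [v', mul_one]
    rw [mul_div_assoc, div_self hnC, mul_one]
  have hg : ∀ k, HasDerivAt (fun k => (hfac t k : ℂ)) ((g' k : ℝ) : ℂ) k := fun k =>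
    (hfac_deriv t k).ofReal_comp
  have hparts := intervalIntegral.integral_mul_deriv_eq_deriv_mul (a := 0) (b := 2 * Real.pi)
    (u := fun k => (hfac t k : ℂ)) (v := v) (u' := fun k => ((g' k : ℝ) : ℂ)) (v' := v')
    (fun k _ => hg k) (fun k _ => hv k)
    ((Complex.continuous_ofReal.comp hg'c).intervalIntegrable _ _)
    ((by simp only [v']; fun_prop : Continuous v').intervalIntegrable _ _)
  have hq : qhat t n = - ∫ k in (0 : ℝ)..(2 * Real.pi), ((g' k : ℝ) : ℂ) * v k := by
    have hb : hfac t (2 * Real.pi) = hfac t 0 := by simp [hfac]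
    have hvb : v (2 * Real.pi) = v 0 := by
      simp only [v]
      congr 1
      have : (n : ℂ) * ((2 * Real.pi : ℝ) : ℂ) * Complex.I = n * (2 * Real.pi * Complex.I) := by
        push_cast; ring
      rw [this, Complex.exp_int_mul_two_pi_mul_I]; simp
    rw [hb, hvb, sub_self, zero_sub] at hparts
    rw [← hparts, qhat, integral_Icc_eq_integral_Ioc,
      ← intervalIntegral.integral_of_le (by positivity)]
    congr 1
    ext k
    rw [mul_comm]
  have hvn : ∀ k, ‖v k‖ = 1 / |(n : ℝ)| := by
    intro k
    simp only [v]
    rw [norm_div, norm_cexp_int, norm_mul, Complex.norm_I, mul_one]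
    congr 1
    rw [Complex.norm_intCast]
  have hI : ∫ k in (0 : ℝ)..(2 * Real.pi), |g' k| ≤ 2 := by
    rw [← intervalIntegral.integral_add_adjacent_intervals (b := Real.pi)
      (hg'c.abs.intervalIntegrable _ _) (hg'c.abs.intervalIntegrable _ _)]
    have hle1 : ∀ k, hfac t k ≤ 1 := by
      intro k
      unfold hfac
      rw [Real.exp_le_one_iff]
      have := Real.cos_le_one k
      have : 0 ≤ t * (2 - 2 * Real.cos k) := mul_nonneg ht.le (by linarith)
      linarith
    have i1 : ∫ k in (0 : ℝ)..Real.pi, |g' k| = hfac t 0 - hfac t Real.pi := by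
      have : ∫ k in (0 : ℝ)..Real.pi, |g' k| = ∫ k in (0 : ℝ)..Real.pi, -g' k := by
        apply intervalIntegral.integral_congr
        intro k hk
        rw [Set.uIcc_of_le hp.le] at hk
        have hs := Real.sin_nonneg_of_nonneg_of_le_pi hk.1 hk.2
        have := hfac_pos t k
        simp only [hg']
        rw [abs_neg, abs_of_nonneg (by positivity), neg_neg]
      rw [this, intervalIntegral.integral_neg,
        intervalIntegral.integral_eq_sub_of_hasDerivAt (fun k _ => hfac_deriv t k)
          (hg'c.intervalIntegrable _ _)]
      ring
    have i2 : ∫ k in Real.pi..(2 * Real.pi), |g' k| = hfac t (2 * Real.pi) - hfac t Real.pi := by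
      have : ∫ k in Real.pi..(2 * Real.pi), |g' k| = ∫ k in Real.pi..(2 * Real.pi), g' k := by
        apply intervalIntegral.integral_congr
        intro k hk
        rw [Set.uIcc_of_le (by linarith)] at hk
        have hs : 0 ≤ -Real.sin k := by
          rw [← Real.sin_sub_pi]
          exact Real.sin_nonneg_of_nonneg_of_le_pi (by linarith [hk.1]) (by linarith [hk.2])
        have := hfac_pos t k
        have h0 : 0 ≤ 2 * t * (-Real.sin k) * hfac t k := by positivity
        simp only [hg']
        rw [abs_of_nonneg (by linarith)]
      rw [this, intervalIntegral.integral_eq_sub_of_hasDerivAt (fun k _ => hfac_deriv t k)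
          (hg'c.intervalIntegrable _ _)]
    rw [i1, i2]
    have := hle1 0
    have := hle1 (2 * Real.pi)
    have := hfac_pos t Real.pi
    linarith
  rw [hq, norm_neg]
  calc _ ≤ ∫ k in (0 : ℝ)..(2 * Real.pi), ‖((g' k : ℝ) : ℂ) * v k‖ :=
        intervalIntegral.norm_integral_le_integral_norm (by positivity)
    _ = ∫ k in (0 : ℝ)..(2 * Real.pi), |g' k| * (1 / |(n : ℝ)|) := by
        congr 1
        ext k
        rw [norm_mul, hvn, Complex.norm_real, Real.norm_eq_abs]
    _ = (∫ k in (0 : ℝ)..(2 * Real.pi), |g' k|) * (1 / |(n : ℝ)|) :=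
        intervalIntegral.integral_mul_const _ _
    _ ≤ 2 * (1 / |(n : ℝ)|) := by gcongr
    _ = _ := by ring

lemma qhat_le {t : ℝ} (ht : 0 < t) (n : ℤ) :
    ‖qhat t n‖ ≤ 6 * Real.pi / max (Real.sqrt t) (rho n) := by
  have hp := Real.pi_pos
  have hp3 := Real.pi_gt_three
  have hst : 0 < Real.sqrt t := Real.sqrt_pos.2 ht
  rcases max_choice (Real.sqrt t) (rho n) with h | h
  · rw [h]; exact qhat_le_sqrt ht n
  · rw [h]
    unfold rho
    rcases max_choice 1 |(n : ℝ)| with h2 | h2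
    · rw [h2, div_one]
      refine (qhat_le_const ht.le n).trans ?_
      linarith
    · rw [h2]
      have hn : n ≠ 0 := by
        rintro rfl
        have := le_max_left 1 |((0 : ℤ) : ℝ)|
        rw [h2] at this
        simp at this
        linarith
      refine (qhat_le_inv ht n hn).trans ?_
      gcongr
      linarith

lemma muk_eq (d : ℕ) (k : Fin d → ℝ) : muk d k = ∑ j, (2 - 2 * Real.cos (k j)) := by
  rw [muk, Finset.sum_sub_distrib, ← Finset.mul_sum]
  simp [mul_comm]

lemma muk_nonneg (d : ℕ) (k : Fin d → ℝ) : 0 ≤ muk d k := by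
  rw [muk_eq]
  exact Finset.sum_nonneg fun j _ => by linarith [Real.cos_le_one (k j)]

lemma muk_cont (d : ℕ) : Continuous (muk d) := by unfold muk; fun_prop

lemma box_compact (d : ℕ) : IsCompact (box d) := isCompact_univ_pi fun _ => isCompact_Icc

lemma volume_box (d : ℕ) : (volume : Measure (Fin d → ℝ)).restrict (box d) =
    Measure.pi fun _ => (volume : Measure ℝ).restrict (Set.Icc 0 (2 * Real.pi)) := by
  rw [volume_pi, box, Measure.restrict_pi_pi]

lemma heat_box (d : ℕ) {t : ℝ} (ht : 0 < t) (z : Fin d → ℤ) :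
    |∫ k in box d, Real.cos (∑ j, (z j : ℝ) * k j) * Real.exp (-(muk d k * t))| ≤
      ∏ j, (6 * Real.pi / max (Real.sqrt t) (rho (z j))) := by
  set F : (Fin d → ℝ) → ℂ := fun k =>
    ∏ j, (Complex.exp ((z j : ℂ) * (k j : ℂ) * Complex.I) * (hfac t (k j) : ℂ)) with hF
  have hFc : Continuous F := by
    have := hfac_cont t
    simp only [hF]
    fun_prop
  have hFi : IntegrableOn F (box d) := hFc.continuousOn.integrableOn_compact (box_compact d)
  have hre : ∀ k, Real.cos (∑ j, (z j : ℝ) * k j) * Real.exp (-(muk d k * t)) = RCLike.re (F k) := by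
    intro k
    have e1 : F k = Complex.exp (((∑ j, (z j : ℝ) * k j : ℝ) : ℂ) * Complex.I) *
        ((Real.exp (-(muk d k * t)) : ℝ) : ℂ) := by
      simp only [hF]
      rw [Finset.prod_mul_distrib, ← Complex.exp_sum, ← Complex.ofReal_prod]
      congr 2
      · push_cast
        rw [Finset.sum_mul]
      · simp only [hfac]
        rw [← Real.exp_sum, muk_eq, Finset.sum_neg_distrib, ← Finset.mul_sum]
        ring_nf
    rw [e1, RCLike.re_eq_complex_re, Complex.re_mul_ofReal, Complex.exp_ofReal_mul_I_re]
  simp_rw [hre]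
  rw [integral_re hFi]
  refine (RCLike.abs_re_le_norm _).trans ?_
  have hprod : ∫ k in box d, F k = ∏ j, qhat t (z j) := by
    rw [volume_box, hF]
    exact integral_fintype_prod_eq_prod (fun j (x : ℝ) =>
      Complex.exp ((z j : ℂ) * (x : ℂ) * Complex.I) * (hfac t x : ℂ))
  rw [hprod, norm_prod]
  exact Finset.prod_le_prod (fun _ _ => norm_nonneg _) fun j _ => qhat_le ht (z j)

lemma time_integral {d : ℕ} {α : ℝ} (hα : α ∈ Set.Ioo (0 : ℝ) (d : ℝ)) :
    ∃ K : ℝ, 0 < K ∧ ∀ ρ : ℝ, 1 ≤ ρ →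
      ∫⁻ t in Set.Ioi (0 : ℝ), ENNReal.ofReal (t ^ (α / 2 - 1) *
        (6 * Real.pi / max (Real.sqrt t) ρ) ^ d) ≤ ENNReal.ofReal (K * ρ ^ (α - d)) := by
  obtain ⟨h0, h1⟩ := hα
  have hp := Real.pi_pos
  have hda : 0 < (d - α) / 2 := by linarith
  refine ⟨(6 * Real.pi) ^ d * (1 / (α / 2) + 1 / ((d - α) / 2)), by positivity, fun ρ hρ => ?_⟩
  have hρ0 : 0 < ρ := by linarith
  have hρ2 : 0 < ρ ^ 2 := by positivity
  have hU : Set.Ioi (0 : ℝ) = Set.Ioc 0 (ρ ^ 2) ∪ Set.Ioi (ρ ^ 2) :=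
    (Set.Ioc_union_Ioi_eq_Ioi hρ2.le).symm
  rw [hU]
  refine (lintegral_union_le _ _ _).trans ?_
  have e1 : ∫⁻ t in Set.Ioc (0 : ℝ) (ρ ^ 2), ENNReal.ofReal (t ^ (α / 2 - 1) *
        (6 * Real.pi / max (Real.sqrt t) ρ) ^ d) ≤
        ENNReal.ofReal ((6 * Real.pi) ^ d * (1 / (α / 2)) * ρ ^ (α - d)) := by
    have hIntg : IntegrableOn (fun t : ℝ => t ^ (α / 2 - 1) * (6 * Real.pi / ρ) ^ d)
        (Set.Ioc 0 (ρ ^ 2)) := by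
      have := (intervalIntegral.intervalIntegrable_rpow' (a := 0) (b := ρ ^ 2)
        (r := α / 2 - 1) (by linarith)).mul_const ((6 * Real.pi / ρ) ^ d)
      rwa [intervalIntegrable_iff_integrableOn_Ioc_of_le hρ2.le] at this
    calc _ ≤ ∫⁻ t in Set.Ioc (0 : ℝ) (ρ ^ 2),
          ENNReal.ofReal (t ^ (α / 2 - 1) * (6 * Real.pi / ρ) ^ d) := by
          refine setLIntegral_mono' measurableSet_Ioc fun t ht => ?_
          apply ENNReal.ofReal_le_ofReal
          have := ht.1
          gcongr
          exact le_max_right _ _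
      _ = ENNReal.ofReal (∫ t in Set.Ioc (0 : ℝ) (ρ ^ 2),
          (t ^ (α / 2 - 1) * (6 * Real.pi / ρ) ^ d)) := by
          rw [ofReal_integral_eq_lintegral_ofReal hIntg]
          filter_upwards [ae_restrict_mem measurableSet_Ioc] with t ht
          have := ht.1
          simp only [Pi.zero_apply]
          positivity
      _ = _ := by
          congr 1
          rw [integral_mul_const, ← intervalIntegral.integral_of_le hρ2.le,
            integral_rpow (Or.inl (by linarith))]
          have e : α / 2 - 1 + 1 = α / 2 := by ring
          rw [e, Real.zero_rpow (by positivity), sub_zero, Real.rpow_sub hρ0, Real.rpow_natCast,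
            ← Real.rpow_natCast ρ 2, ← Real.rpow_mul hρ0.le, div_pow]
          have e' : ((2 : ℕ) : ℝ) * (α / 2) = α := by push_cast; ring
          rw [e']
          field_simp
  have e2 : ∫⁻ t in Set.Ioi (ρ ^ 2), ENNReal.ofReal (t ^ (α / 2 - 1) *
        (6 * Real.pi / max (Real.sqrt t) ρ) ^ d) ≤
        ENNReal.ofReal ((6 * Real.pi) ^ d * (1 / ((d - α) / 2)) * ρ ^ (α - d)) := by
    have hIntg : IntegrableOn (fun t : ℝ => (6 * Real.pi) ^ d * t ^ ((α - d) / 2 - 1))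
        (Set.Ioi (ρ ^ 2)) :=
      (integrableOn_Ioi_rpow_of_lt (by linarith) hρ2).const_mul _
    calc _ ≤ ∫⁻ t in Set.Ioi (ρ ^ 2),
          ENNReal.ofReal ((6 * Real.pi) ^ d * t ^ ((α - d) / 2 - 1)) := by
          refine setLIntegral_mono' measurableSet_Ioi fun t ht => ?_
          apply ENNReal.ofReal_le_ofReal
          have ht0 : 0 < t := hρ2.trans ht
          have hst : 0 < Real.sqrt t := Real.sqrt_pos.2 ht0
          calc t ^ (α / 2 - 1) * (6 * Real.pi / max (Real.sqrt t) ρ) ^ d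
              ≤ t ^ (α / 2 - 1) * (6 * Real.pi / Real.sqrt t) ^ d := by
                gcongr
                exact le_max_left _ _
            _ = _ := by
                rw [div_pow, Real.sqrt_eq_rpow, ← Real.rpow_natCast (t ^ (1 / 2 : ℝ)) d,
                  ← Real.rpow_mul ht0.le, div_eq_mul_inv ((6 * Real.pi) ^ d), ← Real.rpow_neg ht0.le, mul_left_comm,
                  ← Real.rpow_add ht0]
                congr 2
                ring
      _ = ENNReal.ofReal (∫ t in Set.Ioi (ρ ^ 2),
          ((6 * Real.pi) ^ d * t ^ ((α - d) / 2 - 1))) := by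
          rw [ofReal_integral_eq_lintegral_ofReal hIntg]
          filter_upwards [ae_restrict_mem measurableSet_Ioi] with t ht
          have ht0 : 0 < t := hρ2.trans ht
          simp only [Pi.zero_apply]
          positivity
      _ = _ := by
          congr 1
          rw [integral_const_mul, integral_Ioi_rpow_of_lt (by linarith) hρ2]
          have e : (α - d) / 2 - 1 + 1 = -((d - α) / 2) := by ring
          rw [e, ← Real.rpow_natCast ρ 2, ← Real.rpow_mul hρ0.le]
          have e' : ((2 : ℕ) : ℝ) * (-((d - α) / 2)) = α - d := by push_cast; ring
          rw [e', neg_div_neg_eq]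
          ring
  calc _ ≤ _ := add_le_add e1 e2
    _ = _ := by
      rw [← ENNReal.ofReal_add (by positivity) (by positivity)]
      congr 1; ring

lemma time_prod {d : ℕ} (hd : 0 < d) {α : ℝ} (hα : α ∈ Set.Ioo (0 : ℝ) (d : ℝ)) :
    ∃ K : ℝ, 0 < K ∧ ∀ z : Fin d → ℤ,
      ∫⁻ t in Set.Ioi (0 : ℝ), ENNReal.ofReal (t ^ (α / 2 - 1) *
        ∏ j, (6 * Real.pi / max (Real.sqrt t) (rho (z j)))) ≤
      ENNReal.ofReal (K * ∏ j, rho (z j) ^ (α / d - 1)) := by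
  obtain ⟨K, hK, h⟩ := time_integral hα
  refine ⟨K, hK, fun z => ?_⟩
  have hp := Real.pi_pos
  have hd0 : (0 : ℝ) < d := by exact_mod_cast hd
  have hsum : ∑ _j : Fin d, (1 / (d : ℝ)) = 1 := by simp [hd0.ne']
  have hprodK : ∀ x : ℝ, 0 ≤ x → ∏ _j : Fin d, x ^ (1 / (d : ℝ)) = x := by
    intro x hx
    rw [Finset.prod_const, Finset.card_univ, Fintype.card_fin, one_div,
      Real.rpow_inv_natCast_pow hx hd.ne']
  set f : Fin d → ℝ → ℝ≥0∞ := fun j t => ENNReal.ofReal (t ^ (α / 2 - 1) *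
        (6 * Real.pi / max (Real.sqrt t) (rho (z j))) ^ d) with hf
  have hH := ENNReal.lintegral_prod_norm_pow_le (μ := volume.restrict (Set.Ioi (0 : ℝ)))
    Finset.univ (f := f) (fun j _ => by
      apply Measurable.aemeasurable
      simp only [hf]
      fun_prop) (p := fun _ => 1 / (d : ℝ)) hsum (fun _ _ => by positivity)
  calc _ = ∫⁻ t in Set.Ioi (0 : ℝ), ∏ j, f j t ^ (1 / (d : ℝ)) := by
        refine setLIntegral_congr_fun measurableSet_Ioi fun t ht => ?_
        have ht0 : 0 < t := ht
        have hb : ∀ j, 0 ≤ 6 * Real.pi / max (Real.sqrt t) (rho (z j)) := fun j => by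
          have := rho_pos (z j); positivity
        have e : ∀ j, f j t ^ (1 / (d : ℝ)) = ENNReal.ofReal ((t ^ (α / 2 - 1)) ^ (1 / (d : ℝ)) *
            (6 * Real.pi / max (Real.sqrt t) (rho (z j)))) := by
          intro j
          simp only [hf]
          rw [ENNReal.ofReal_rpow_of_nonneg (mul_nonneg (by positivity) (pow_nonneg (hb j) _))
            (by positivity), Real.mul_rpow (by positivity) (pow_nonneg (hb j) _)]
          congr 2
          rw [one_div, Real.pow_rpow_inv_natCast (hb j) hd.ne']
        simp_rw [e]
        rw [← ENNReal.ofReal_prod_of_nonneg (fun j _ => mul_nonneg (by positivity) (hb j)),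
          Finset.prod_mul_distrib, hprodK _ (by positivity)]
    _ ≤ ∏ j, (∫⁻ t in Set.Ioi (0 : ℝ), f j t) ^ (1 / (d : ℝ)) := hH
    _ ≤ ∏ j, (ENNReal.ofReal (K * rho (z j) ^ (α - d))) ^ (1 / (d : ℝ)) := by
        gcongr with j
        exact h (rho (z j)) (one_le_rho _)
    _ = _ := by
        have e : ∀ j, (ENNReal.ofReal (K * rho (z j) ^ (α - d))) ^ (1 / (d : ℝ)) =
            ENNReal.ofReal (K ^ (1 / (d : ℝ)) * rho (z j) ^ (α / d - 1)) := by
          intro j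
          have := rho_pos (z j)
          rw [ENNReal.ofReal_rpow_of_nonneg (by positivity) (by positivity),
            Real.mul_rpow hK.le (by positivity), ← Real.rpow_mul this.le]
          congr 3
          field_simp
        simp_rw [e]
        rw [← ENNReal.ofReal_prod_of_nonneg (fun j _ => by
          have := rho_pos (z j); positivity), Finset.prod_mul_distrib, hprodK _ hK.le]

lemma gamma_sub {a m : ℝ} (ha : 0 < a) (hm : 0 ≤ m) :
    ∫ t in Set.Ioi (0 : ℝ), t ^ (a - 1) * Real.exp (-(m * t)) = Real.Gamma a * m ^ (-a) := by
  rcases hm.eq_or_lt with h | h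
  · subst h
    simp [Real.zero_rpow (neg_ne_zero.2 ha.ne'), setIntegral_Ioi_zero_rpow]
  · rw [Real.integral_rpow_mul_exp_neg_mul_Ioi ha h, one_div, Real.inv_rpow h.le,
      ← Real.rpow_neg h.le, mul_comm]

lemma riesz_bound {d : ℕ} (hd : 0 < d) {α : ℝ} (hα : α ∈ Set.Ioo (0 : ℝ) (d : ℝ)) :
    ∃ K : ℝ, 0 < K ∧ ∀ z : Fin d → ℤ,
      |∫ k in box d, Real.cos (∑ j, (z j : ℝ) * k j) * muk d k ^ (-(α / 2))| ≤
        K * ∏ j, rho (z j) ^ (α / d - 1) := by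
  obtain ⟨K, hK, h⟩ := time_prod hd hα
  have hα2 : 0 < α / 2 := half_pos hα.1
  have hG : 0 < Real.Gamma (α / 2) := Real.Gamma_pos_of_pos hα2
  refine ⟨K / Real.Gamma (α / 2), by positivity, fun z => ?_⟩
  have hmc := muk_cont d
  set f : (Fin d → ℝ) → ℝ → ℝ := fun k t =>
    Real.cos (∑ j, (z j : ℝ) * k j) * (t ^ (α / 2 - 1) * Real.exp (-(muk d k * t))) with hf
  have hmeas : Measurable (Function.uncurry f) := by
    have := hmc.measurable
    simp only [hf, Function.uncurry_def]
    fun_prop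
  have hIntg : Integrable (Function.uncurry f)
      ((volume.restrict (box d)).prod (volume.restrict (Set.Ioi (0 : ℝ)))) := by
    refine ⟨hmeas.aestronglyMeasurable, ?_⟩
    rw [HasFiniteIntegral, lintegral_prod_symm _ hmeas.enorm.aemeasurable]
    refine lt_of_le_of_lt ?_ (ENNReal.ofReal_lt_top (r := K * ∏ j, rho ((0 : Fin d → ℤ) j) ^ (α / d - 1)))
    refine le_trans ?_ (h 0)
    refine setLIntegral_mono' measurableSet_Ioi fun t ht => ?_
    have ht0 : 0 < t := ht
    have hexp : IntegrableOn (fun k => Real.exp (-(muk d k * t))) (box d) :=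
      (by fun_prop : Continuous fun k => Real.exp (-(muk d k * t))).continuousOn.integrableOn_compact
        (box_compact d)
    calc _ ≤ ∫⁻ k in box d, ENNReal.ofReal (t ^ (α / 2 - 1) * Real.exp (-(muk d k * t))) := by
          refine lintegral_mono fun k => ?_
          rw [Function.uncurry_apply_pair, ← ofReal_norm]
          apply ENNReal.ofReal_le_ofReal
          simp only [hf]
          rw [norm_mul, Real.norm_of_nonneg (by positivity : 0 ≤ t ^ (α / 2 - 1) * Real.exp (-(muk d k * t)))]
          calc _ ≤ 1 * (t ^ (α / 2 - 1) * Real.exp (-(muk d k * t))) := by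
                gcongr
                exact Real.abs_cos_le_one _
            _ = _ := one_mul _
      _ = ENNReal.ofReal (∫ k in box d, t ^ (α / 2 - 1) * Real.exp (-(muk d k * t))) := by
          rw [ofReal_integral_eq_lintegral_ofReal (hexp.const_mul _)]
          filter_upwards with k
          simp only [Pi.zero_apply]
          positivity
      _ ≤ _ := by
          apply ENNReal.ofReal_le_ofReal
          rw [integral_const_mul]
          gcongr
          have := (le_abs_self _).trans (heat_box d ht0 0)
          simpa using this
  have hswap := integral_integral_swap hIntg
  have hL : ∫ k in box d, ∫ t in Set.Ioi (0 : ℝ), f k t = Real.Gamma (α / 2) *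
      ∫ k in box d, Real.cos (∑ j, (z j : ℝ) * k j) * muk d k ^ (-(α / 2)) := by
    rw [← integral_const_mul]
    congr 1
    ext k
    simp only [hf]
    rw [integral_const_mul, gamma_sub hα2 (muk_nonneg d k)]
    ring
  have hR : ‖∫ t in Set.Ioi (0 : ℝ), ∫ k in box d, f k t‖ₑ ≤
      ENNReal.ofReal (K * ∏ j, rho (z j) ^ (α / d - 1)) := by
    refine (enorm_integral_le_lintegral_enorm _).trans (le_trans ?_ (h z))
    refine setLIntegral_mono' measurableSet_Ioi fun t ht => ?_
    have ht0 : 0 < t := ht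
    rw [← ofReal_norm]
    apply ENNReal.ofReal_le_ofReal
    have e : ∫ k in box d, f k t = t ^ (α / 2 - 1) *
        ∫ k in box d, Real.cos (∑ j, (z j : ℝ) * k j) * Real.exp (-(muk d k * t)) := by
      rw [← integral_const_mul]
      congr 1
      ext k
      simp only [hf]
      ring
    rw [e, norm_mul, Real.norm_of_nonneg (by positivity : 0 ≤ t ^ (α / 2 - 1)), Real.norm_eq_abs]
    gcongr
    exact heat_box d ht0 z
  have hP : 0 ≤ K * ∏ j, rho (z j) ^ (α / d - 1) :=
    mul_nonneg hK.le (Finset.prod_nonneg fun j _ => Real.rpow_nonneg (rho_pos _).le _)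
  rw [← hswap, hL, ← ofReal_norm, ENNReal.ofReal_le_ofReal_iff hP, norm_mul,
    Real.norm_of_nonneg hG.le, Real.norm_eq_abs] at hR
  rw [div_mul_eq_mul_div, le_div_iff₀ hG, mul_comm]
  exact hR

lemma Riesz_le {d : ℕ} (hd : 0 < d) {α : ℝ} (hα : α ∈ Set.Ioo (0 : ℝ) (d : ℝ)) :
    ∃ K : ℝ, 0 < K ∧ ∀ x y : Z d,
      ENNReal.ofReal |Riesz d α x y| ≤ ENNReal.ofReal K * Wker d (α / d) (x - y) := by
  obtain ⟨K, hK, h⟩ := riesz_bound hd hα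
  have hp := Real.pi_pos
  set c := Kfrac d α * (2 * Real.pi) ^ (-(d : ℝ)) with hc
  refine ⟨(|c| + 1) * K, by positivity, fun x y => ?_⟩
  have hW : Wker d (α / d) (x - y) = ENNReal.ofReal (∏ j, rho ((x - y) j) ^ (α / d - 1)) := by
    rw [ENNReal.ofReal_prod_of_nonneg (fun j _ => Real.rpow_nonneg (rho_pos _).le _)]
    rfl
  rw [hW, ← ENNReal.ofReal_mul (by positivity)]
  apply ENNReal.ofReal_le_ofReal
  have hz := h (x - y)
  have : Riesz d α x y = c * ∫ k in box d,
      Real.cos (∑ j, ((x - y) j : ℝ) * k j) * muk d k ^ (-(α / 2)) := rfl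
  rw [this, abs_mul, mul_assoc]
  gcongr
  linarith

theorem discrete_HLS_convolution_form
    {d : ℕ} (hd : 0 < d) {α r : ℝ} (hα : α ∈ Set.Ioo (0 : ℝ) (d : ℝ))
    (hr : 1 < r) (hrd : r < (d : ℝ) / α) :
    ∃ C : ℝ, 0 < C ∧ ∀ u : Z d → ℝ, (Summable fun x : Z d => |u x| ^ r) →
      (∀ x : Z d, Summable fun y : Z d => Riesz d α x y * u y) ∧
      (Summable fun x : Z d => |conv d α u x| ^ ((d : ℝ) * r / (d - α * r))) ∧
      lnorm ((d : ℝ) * r / (d - α * r)) (conv d α u) ≤ C * lnorm r u := by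
  have hd0 : (0 : ℝ) < d := by exact_mod_cast hd
  have hα0 := hα.1
  have hr0 : 0 < r := by linarith
  have hαr : 0 < (d : ℝ) - α * r := by
    rw [lt_div_iff₀ hα0] at hrd
    linarith
  set q := (d : ℝ) * r / (d - α * r) with hqdef
  have hq : 1 < q := by
    rw [hqdef, lt_div_iff₀ hαr]
    nlinarith [mul_pos hα0 hr0]
  have hq0 : 0 < q := by linarith
  have hqe : 1 / q = 1 / r - α / d := by
    rw [hqdef]; field_simp
  obtain ⟨C, hC, hH⟩ := hls_prod (a := α / d) (by positivity) (by rw [div_lt_one hd0]; exact hα.2)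
    hr hq hqe d
  obtain ⟨K, hK, hR⟩ := Riesz_le hd hα
  refine ⟨K * C, by positivity, fun u hu => ?_⟩
  set f : Z d → ℝ≥0∞ := fun y => ENNReal.ofReal |u y| with hf
  set S := ∑' x : Z d, |u x| ^ r with hS
  have hS0 : 0 ≤ S := tsum_nonneg fun x => by positivity
  have hfS : ∑' y, f y ^ r = ENNReal.ofReal S := by
    rw [hS, ENNReal.ofReal_tsum_of_nonneg (fun x => by positivity) hu]
    refine tsum_congr fun y => ?_
    simp only [hf]
    rw [ENNReal.ofReal_rpow_of_nonneg (abs_nonneg _) hr0.le]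
  set T : Z d → ℝ≥0∞ := fun x => ∑' y, ENNReal.ofReal |Riesz d α x y * u y| with hT
  have hTle : ∀ x, T x ≤ ENNReal.ofReal K * ∑' y, Wker d (α / d) (x - y) * f y := by
    intro x
    rw [← ENNReal.tsum_mul_left]
    refine ENNReal.tsum_le_tsum fun y => ?_
    rw [abs_mul, ENNReal.ofReal_mul (abs_nonneg _), ← mul_assoc]
    exact mul_le_mul_left (hR x y) _
  have hTq : (∑' x, T x ^ q) ^ (1 / q) ≤ ENNReal.ofReal (K * C * S ^ (1 / r)) := by
    calc (∑' x, T x ^ q) ^ (1 / q)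
        ≤ (∑' x, (ENNReal.ofReal K * ∑' y, Wker d (α / d) (x - y) * f y) ^ q) ^ (1 / q) := by
          gcongr with x
          exact hTle x
      _ = ENNReal.ofReal K * (∑' x, (∑' y, Wker d (α / d) (x - y) * f y) ^ q) ^ (1 / q) := by
          simp_rw [ENNReal.mul_rpow_of_nonneg _ _ hq0.le]
          rw [ENNReal.tsum_mul_left, ENNReal.mul_rpow_of_nonneg _ _ (by positivity),
            ← ENNReal.rpow_mul, mul_one_div_cancel hq0.ne', ENNReal.rpow_one]
      _ ≤ ENNReal.ofReal K * (ENNReal.ofReal C * (∑' y, f y ^ r) ^ (1 / r)) := by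
          gcongr
          exact hH f
      _ = _ := by
          rw [hfS, ENNReal.ofReal_rpow_of_nonneg hS0 (by positivity), ENNReal.ofReal_mul (by positivity),
            ENNReal.ofReal_mul hK.le, mul_assoc]
  have hB0 : 0 ≤ K * C * S ^ (1 / r) := by positivity
  have hTsum : ∑' x, T x ^ q ≤ ENNReal.ofReal ((K * C * S ^ (1 / r)) ^ q) := by
    rw [← ENNReal.ofReal_rpow_of_nonneg hB0 hq0.le]
    calc ∑' x, T x ^ q = ((∑' x, T x ^ q) ^ (1 / q)) ^ q := by
          rw [← ENNReal.rpow_mul, one_div_mul_cancel hq0.ne', ENNReal.rpow_one]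
      _ ≤ _ := by gcongr
  have hTtop : ∑' x, T x ^ q ≠ ⊤ := ne_top_of_le_ne_top ENNReal.ofReal_ne_top hTsum
  have hTx : ∀ x, T x ≠ ⊤ := by
    intro x hx
    have := ENNReal.ne_top_of_tsum_ne_top hTtop x
    rw [hx, ENNReal.top_rpow_of_pos hq0] at this
    exact this rfl
  have hsum : ∀ x : Z d, Summable fun y : Z d => |Riesz d α x y * u y| := by
    intro x
    have := ENNReal.summable_toReal (hTx x)
    refine this.congr fun y => ?_
    rw [ENNReal.toReal_ofReal (abs_nonneg _)]
  have hconv : ∀ x, ENNReal.ofReal (|conv d α u x| ^ q) ≤ T x ^ q := by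
    intro x
    rw [← ENNReal.ofReal_rpow_of_nonneg (abs_nonneg _) hq0.le]
    gcongr
    simp only [hT]
    rw [← ENNReal.ofReal_tsum_of_nonneg (fun _ => abs_nonneg _) (hsum x)]
    apply ENNReal.ofReal_le_ofReal
    have := norm_tsum_le_tsum_norm (f := fun y => Riesz d α x y * u y)
      (by simpa only [Real.norm_eq_abs] using hsum x)
    simpa only [Real.norm_eq_abs, conv] using this
  have hle : ∑' x, ENNReal.ofReal (|conv d α u x| ^ q) ≤
      ENNReal.ofReal ((K * C * S ^ (1 / r)) ^ q) := (ENNReal.tsum_le_tsum hconv).trans hTsum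
  have hcs : Summable fun x : Z d => |conv d α u x| ^ q := by
    have := ENNReal.summable_toReal (ne_top_of_le_ne_top ENNReal.ofReal_ne_top hle)
    refine this.congr fun y => ?_
    rw [ENNReal.toReal_ofReal (by positivity)]
  refine ⟨fun x => (hsum x).of_abs, hcs, ?_⟩
  rw [← ENNReal.ofReal_tsum_of_nonneg (fun _ => by positivity) hcs,
    ENNReal.ofReal_le_ofReal_iff (by positivity)] at hle
  unfold lnorm
  rw [← hS]
  calc _ ≤ ((K * C * S ^ (1 / r)) ^ q) ^ (1 / q) :=
        Real.rpow_le_rpow (tsum_nonneg fun _ => by positivity) hle (by positivity)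
    _ = _ := by rw [← Real.rpow_mul hB0, mul_one_div_cancel hq0.ne', Real.rpow_one]

end DiscreteChoquard
end
end

section
/- (Compact embedding.) Assume (h1) and (h2). Let q ∈ [p,∞) and let (u_n) be a sequence of functions ℤ^d → ℝ with sup_n ‖u_n‖_{H_{s,p}} < ∞. Then there exist a subsequence (u_{n_k}) and a function u : ℤ^d → ℝ with ‖u‖_{H_{s,p}} < ∞ such that u_{n_k}(x) → u(x) for every x ∈ ℤ^d and ∑_{x∈ℤ^d}|u_{n_k}(x) − u(x)|^q → 0 as k → ∞. -/
open MeasureTheory Filter Topology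
open scoped ENNReal

noncomputable section

namespace DiscreteChoquard

variable {d : ℕ}

theorem tail_aux {ι : Type*} {h : ι → ℝ} (hh2 : Tendsto h cofinite atTop)
    {f : ℕ → ι → ℝ} (hf : ∀ k x, 0 ≤ f k x)
    (hlim : ∀ x, Tendsto (fun k => f k x) atTop (nhds 0)) (hh : ∀ x, 0 ≤ h x)
    {M : ℝ} (hM : ∀ k (S : Finset ι), ∑ x ∈ S, h x * f k x ≤ M) :
    Tendsto (fun k => ∑' x, f k x) atTop (nhds 0) := by
  classical
  have hM0 : 0 ≤ M := by simpa using hM 0 ∅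
  rw [Metric.tendsto_atTop]
  intro ε hε
  set R : ℝ := (M + 1) / (ε / 2) with hR
  have hRpos : 0 < R := by positivity
  have hfin : {x | ¬ (R ≤ h x)}.Finite := hh2.eventually_ge_atTop R
  set F := hfin.toFinset with hF
  have hsum : Tendsto (fun k => ∑ x ∈ F, f k x) atTop (nhds 0) := by
    have := tendsto_finsetSum F (fun x _ => hlim x)
    simpa using this
  obtain ⟨N, hN⟩ := (Metric.tendsto_atTop.1 hsum) (ε / 2) (by positivity)
  refine ⟨N, fun k hk => ?_⟩
  have h1 := hN k hk
  rw [Real.dist_0_eq_abs] at h1 ⊢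
  have h2 := (abs_lt.1 h1).2
  have hMR : M / R < ε / 2 := by
    rw [div_lt_iff₀ hRpos, hR]
    field_simp
    linarith
  have key : ∑' x, f k x ≤ ∑ x ∈ F, f k x + M / R := by
    refine Real.tsum_le_of_sum_le (hf k) (fun S => ?_)
    have e1 : ∑ x ∈ S, f k x ≤ ∑ x ∈ F, f k x + ∑ x ∈ S \ F, f k x := by
      rw [← Finset.sum_union Finset.disjoint_sdiff]
      refine Finset.sum_le_sum_of_subset_of_nonneg ?_ (fun x _ _ => hf k x)
      intro x hx
      simp [hx]
    have e2 : ∑ x ∈ S \ F, f k x ≤ M / R := by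
      rw [le_div_iff₀ hRpos, Finset.sum_mul]
      refine le_trans (Finset.sum_le_sum fun x hx => ?_) (hM k (S \ F))
      have hx' : R ≤ h x := by
        have := (Finset.mem_sdiff.1 hx).2
        simpa [hF] using this
      rw [mul_comm]
      exact mul_le_mul_of_nonneg_right hx' (hf k x)
    linarith
  rw [abs_of_nonneg (tsum_nonneg (hf k))]
  linarith

theorem compact_embedding
    {d : ℕ} (hd : 0 < d) {s p : ℝ} (hs : s ∈ Set.Ioo (0 : ℝ) 1) (hp : 2 ≤ p)
    {W : Z d → Z d → ℝ} (hW : KernelOK d s W)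
    {h : Z d → ℝ} {h₀ : ℝ} (hh₀ : 0 < h₀) (hh1 : ∀ x, h₀ ≤ h x)
    (hh2 : H2 h)
    {q : ℝ} (hq : p ≤ q) (u : ℕ → Z d → ℝ) (hmem : ∀ n, memH W h p (u n))
    {B : ℝ} (hB : ∀ n, normH W h p (u n) ≤ B) :
    ∃ φ : ℕ → ℕ, StrictMono φ ∧ ∃ v : Z d → ℝ, memH W h p v ∧
      (∀ x : Z d, Tendsto (fun k => u (φ k) x) atTop (nhds (v x))) ∧
      Tendsto (fun k => ∑' x : Z d, |u (φ k) x - v x| ^ q) atTop (nhds 0) := by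
  obtain ⟨-, hWpos, -⟩ := hW
  have hp0 : 0 < p := by linarith
  have hq0 : 0 < q := by linarith
  have hh : ∀ x, 0 < h x := fun x => lt_of_lt_of_le hh₀ (hh1 x)
  have hgn : ∀ (w : Z d → ℝ) x, 0 ≤ gradNorm W w x := fun w x => Real.sqrt_nonneg _
  have htn : ∀ (w : Z d → ℝ) x, 0 ≤ gradNorm W w x ^ p + h x * |w x| ^ p := fun w x =>
    add_nonneg (Real.rpow_nonneg (hgn w x) _)
      (mul_nonneg (hh x).le (Real.rpow_nonneg (abs_nonneg _) _))
  have hHn : ∀ n, 0 ≤ HnormP W h p (u n) := fun n => tsum_nonneg (htn (u n))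
  have hB0 : 0 ≤ B := le_trans (Real.rpow_nonneg (hHn 0) _) (hB 0)
  obtain ⟨M, hMdef⟩ : ∃ M, M = B ^ p := ⟨_, rfl⟩
  have hM0 : 0 ≤ M := hMdef ▸ Real.rpow_nonneg hB0 _
  have hHM : ∀ n, HnormP W h p (u n) ≤ M := by
    intro n
    have h1 := Real.rpow_le_rpow (Real.rpow_nonneg (hHn n) _) (hB n) hp0.le
    rw [← Real.rpow_mul (hHn n), one_div, inv_mul_cancel₀ hp0.ne', Real.rpow_one] at h1
    rw [hMdef]; exact h1
  have hfinM : ∀ n (S : Finset (Z d)),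
      ∑ x ∈ S, (gradNorm W (u n) x ^ p + h x * |u n x| ^ p) ≤ M := fun n S =>
    le_trans ((hmem n).2.sum_le_tsum S (fun x _ => htn (u n) x)) (hHM n)
  have hptM : ∀ n x, gradNorm W (u n) x ^ p + h x * |u n x| ^ p ≤ M := by
    intro n x
    simpa using hfinM n {x}
  have hrt : ∀ {a b : ℝ}, 0 ≤ a → 0 ≤ b → a ^ p ≤ b → a ≤ b ^ (1 / p) := by
    intro a b ha hb hab
    have := Real.rpow_le_rpow (Real.rpow_nonneg ha _) hab (by positivity : 0 ≤ 1 / p)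
    rwa [← Real.rpow_mul ha, one_div, mul_inv_cancel₀ hp0.ne', Real.rpow_one, ← one_div] at this
  obtain ⟨K, hK⟩ : ∃ K, K = (M / h₀) ^ (1 / p) := ⟨_, rfl⟩
  have hK0 : 0 ≤ K := hK ▸ Real.rpow_nonneg (by positivity) _
  have huK : ∀ n x, |u n x| ≤ K := by
    intro n x
    rw [hK]
    refine hrt (abs_nonneg _) (by positivity) ?_
    rw [le_div_iff₀ hh₀]
    have h1 := hptM n x
    have h2 := Real.rpow_nonneg (hgn (u n) x) p
    have h3 := mul_le_mul_of_nonneg_right (hh1 x) (Real.rpow_nonneg (abs_nonneg (u n x)) p)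
    linarith
  have hgM : ∀ n x, gradNorm W (u n) x ≤ M ^ (1 / p) := by
    intro n x
    refine hrt (hgn _ _) hM0 ?_
    have h1 := hptM n x
    have h3 := mul_nonneg (hh x).le (Real.rpow_nonneg (abs_nonneg (u n x)) p)
    linarith
  -- extraction of a pointwise convergent subsequence
  have hcomp : IsCompact (Set.univ.pi fun _ : Z d => Set.Icc (-K) K) :=
    isCompact_univ_pi fun _ => isCompact_Icc
  obtain ⟨v, hvmem, φ, hφ, hconv⟩ := hcomp.tendsto_subseq
    (x := u) (fun n x _ => abs_le.1 (huK n x))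
  have hpt : ∀ x, Tendsto (fun k => u (φ k) x) atTop (nhds (v x)) := fun x =>
    (tendsto_pi_nhds.1 hconv) x
  have hvK : ∀ x, |v x| ≤ K := fun x => abs_le.2 (hvmem x (Set.mem_univ x))
  have hwn : ∀ (w : Z d → ℝ) x y, 0 ≤ W x y * (w x - w y) ^ 2 := fun w x y =>
    mul_nonneg (hWpos x y).le (sq_nonneg _)
  have hptT : ∀ x (T : Finset (Z d)), Tendsto
      (fun k => ∑ y ∈ T, W x y * (u (φ k) x - u (φ k) y) ^ 2) atTop
      (nhds (∑ y ∈ T, W x y * (v x - v y) ^ 2)) := fun x T =>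
    tendsto_finsetSum T fun y _ => (((hpt x).sub (hpt y)).pow 2).const_mul _
  have hsumv : ∀ x, Summable fun y => W x y * (v x - v y) ^ 2 := by
    intro x
    refine summable_of_sum_le (c := 2 * (M ^ (1 / p)) ^ 2) (hwn v x) (fun T => ?_)
    refine le_of_tendsto' (hptT x T) (fun k => ?_)
    have h1 := (hmem (φ k)).1 x |>.sum_le_tsum T (fun y _ => hwn (u (φ k)) x y)
    have h2 := pow_le_pow_left₀ (hgn _ _) (hgM (φ k) x) 2
    unfold gradNorm at h2
    rw [Real.sq_sqrt (mul_nonneg (by norm_num) (tsum_nonneg (hwn (u (φ k)) x)))] at h2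
    linarith
  have habs : ∀ x {r : ℝ}, 0 < r →
      Tendsto (fun k => |u (φ k) x| ^ r) atTop (nhds (|v x| ^ r)) := fun x r hr =>
    (hpt x).abs.rpow_const (Or.inr hr.le)
  have hvM : ∀ S : Finset (Z d), ∑ x ∈ S, (gradNorm W v x ^ p + h x * |v x| ^ p) ≤ M := by
    intro S
    have hT : ∀ T : Finset (Z d), ∑ x ∈ S,
        (Real.sqrt ((1 / 2) * ∑ y ∈ T, W x y * (v x - v y) ^ 2) ^ p + h x * |v x| ^ p) ≤ M := by
      intro T
      have ht : Tendsto (fun k => ∑ x ∈ S,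
        (Real.sqrt ((1 / 2) * ∑ y ∈ T, W x y * (u (φ k) x - u (φ k) y) ^ 2) ^ p
          + h x * |u (φ k) x| ^ p)) atTop (nhds (∑ x ∈ S,
        (Real.sqrt ((1 / 2) * ∑ y ∈ T, W x y * (v x - v y) ^ 2) ^ p + h x * |v x| ^ p))) :=
        tendsto_finsetSum S fun x _ =>
          ((((hptT x T).const_mul _).sqrt).rpow_const (Or.inr hp0.le)).add
            ((habs x hp0).const_mul _)
      refine le_of_tendsto' ht (fun k => le_trans (Finset.sum_le_sum fun x _ => ?_)
        (hfinM (φ k) S))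
      have h1 := (hmem (φ k)).1 x |>.sum_le_tsum T (fun y _ => hwn (u (φ k)) x y)
      unfold gradNorm
      gcongr
    have ht : Tendsto (fun T : Finset (Z d) => ∑ x ∈ S,
        (Real.sqrt ((1 / 2) * ∑ y ∈ T, W x y * (v x - v y) ^ 2) ^ p + h x * |v x| ^ p)) atTop
        (nhds (∑ x ∈ S, (gradNorm W v x ^ p + h x * |v x| ^ p))) :=
      tendsto_finsetSum S fun x _ =>
        (((Tendsto.const_mul _ (hsumv x).hasSum).sqrt).rpow_const (Or.inr hp0.le)).add_const _
    exact le_of_tendsto' ht hT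
  refine ⟨φ, hφ, v, ⟨hsumv, summable_of_sum_le (htn v) hvM⟩, hpt, ?_⟩
  refine tail_aux (M := (2 * K) ^ (q - p) * (2 ^ p * (M + M))) hh2
    (fun k x => Real.rpow_nonneg (abs_nonneg _) _) (fun x => ?_) (fun x => (hh x).le)
    (fun k S => ?_)
  · have := (((hpt x).sub_const (v x)).abs).rpow_const (p := q) (Or.inr hq0.le)
    simpa [Real.zero_rpow hq0.ne'] using this
  · have hpoint : ∀ x ∈ S, h x * |u (φ k) x - v x| ^ q ≤ (2 * K) ^ (q - p) * (2 ^ p *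
        ((gradNorm W (u (φ k)) x ^ p + h x * |u (φ k) x| ^ p)
          + (gradNorm W v x ^ p + h x * |v x| ^ p))) := by
      intro x _
      have ha : |u (φ k) x - v x| ≤ |u (φ k) x| + |v x| := abs_sub _ _
      have ha2 : |u (φ k) x - v x| ≤ 2 * K := by linarith [huK (φ k) x, hvK x]
      have hq1 : |u (φ k) x - v x| ^ q
          = |u (φ k) x - v x| ^ (q - p) * |u (φ k) x - v x| ^ p := by
        rw [← Real.rpow_add_of_nonneg (abs_nonneg _) (by linarith) hp0.le, sub_add_cancel]
      have hmx : |u (φ k) x - v x| ^ p ≤ 2 ^ p * (|u (φ k) x| ^ p + |v x| ^ p) := by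
        have hu := Real.rpow_nonneg (abs_nonneg (u (φ k) x)) p
        have hv := Real.rpow_nonneg (abs_nonneg (v x)) p
        have h2p : (0 : ℝ) ≤ 2 ^ p := Real.rpow_nonneg (by norm_num) _
        rcases le_total |u (φ k) x| |v x| with hle | hle
        · have := Real.rpow_le_rpow (abs_nonneg _)
            (by linarith : |u (φ k) x - v x| ≤ 2 * |v x|) hp0.le
          rw [Real.mul_rpow (by norm_num) (abs_nonneg _)] at this
          nlinarith [mul_nonneg h2p hu]
        · have := Real.rpow_le_rpow (abs_nonneg _)
            (by linarith : |u (φ k) x - v x| ≤ 2 * |u (φ k) x|) hp0.le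
          rw [Real.mul_rpow (by norm_num) (abs_nonneg _)] at this
          nlinarith [mul_nonneg h2p hv]
      have h1 : |u (φ k) x - v x| ^ (q - p) ≤ (2 * K) ^ (q - p) :=
        Real.rpow_le_rpow (abs_nonneg _) ha2 (by linarith)
      have hg1 := Real.rpow_nonneg (hgn (u (φ k)) x) p
      have hg2 := Real.rpow_nonneg (hgn v x) p
      have hx := (hh x).le
      calc h x * |u (φ k) x - v x| ^ q
          ≤ h x * ((2 * K) ^ (q - p) * (2 ^ p * (|u (φ k) x| ^ p + |v x| ^ p))) := by
            rw [hq1]; gcongr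
        _ = (2 * K) ^ (q - p) * (2 ^ p * (h x * |u (φ k) x| ^ p + h x * |v x| ^ p)) := by ring
        _ ≤ _ := by
            gcongr <;> linarith
    refine le_trans (Finset.sum_le_sum hpoint) ?_
    rw [← Finset.mul_sum, ← Finset.mul_sum, Finset.sum_add_distrib]
    have := hfinM (φ k) S
    have := hvM S
    gcongr

end DiscreteChoquard
end
end

section
/- Assume (h1), (h2) and (f1)–(f3). Let (u_n) be a sequence of functions ℤ^d → ℝ with u_n ≥ 0 for every n and sup_n ‖u_n‖_{H_{s,p}} < ∞. Then there exist a subsequence (u_{n_k}) and a function u : ℤ^d → ℝ with u ≥ 0 and ‖u‖_{H_{s,p}} < ∞ such that, as k → ∞, ∑_{x∈ℤ^d}(R_α∗F(u_{n_k}))(x)·F(u_{n_k}(x)) → ∑_{x∈ℤ^d}(R_α∗F(u))(x)·F(u(x)) and ∑_{x∈ℤ^d}(R_α∗F(u_{n_k}))(x)·f(u_{n_k}(x))·u_{n_k}(x) → ∑_{x∈ℤ^d}(R_α∗F(u))(x)·f(u(x))·u(x) (all series converging absolutely). -/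
open MeasureTheory Filter Topology
open scoped ENNReal

noncomputable section

namespace DiscreteChoquard

variable {d : ℕ}

section Helpers

lemma sin_half_lower {k : ℝ} (hk : k ∈ Set.Ioo (0:ℝ) (2 * Real.pi)) :
    0 < min k (2 * Real.pi - k) / Real.pi ∧
    min k (2 * Real.pi - k) / Real.pi ≤ Real.sin (k / 2) := by
  have hpi := Real.pi_pos
  obtain ⟨h0, h1⟩ := hk
  refine ⟨div_pos (lt_min h0 (by linarith)) hpi, ?_⟩
  rcases le_total k Real.pi with h | h
  · rw [min_eq_left (by linarith)]
    have := Real.mul_le_sin (x := k / 2) (by linarith) (by linarith)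
    calc k / Real.pi = 2 / Real.pi * (k / 2) := by ring
      _ ≤ _ := this
  · rw [min_eq_right (by linarith)]
    have := Real.mul_le_sin (x := Real.pi - k / 2) (by linarith) (by linarith)
    rw [Real.sin_pi_sub] at this
    calc (2 * Real.pi - k) / Real.pi = 2 / Real.pi * (Real.pi - k / 2) := by ring
      _ ≤ _ := this

lemma one_dim_integrable {β : ℝ} (hβ0 : 0 < β) (hβ : β < 1) :
    Integrable (fun k : ℝ => (min k (2 * Real.pi - k) / Real.pi) ^ (-β))
      (volume.restrict (Set.Ioo (0:ℝ) (2 * Real.pi))) := by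
  have hpi := Real.pi_pos
  have h1 : IntervalIntegrable (fun k : ℝ => k ^ (-β)) volume 0 (2 * Real.pi) :=
    intervalIntegral.intervalIntegrable_rpow' (by linarith)
  have h2 : IntervalIntegrable (fun k : ℝ => (2 * Real.pi - k) ^ (-β)) volume 0 (2 * Real.pi) := by
    have := (h1.comp_sub_left (2 * Real.pi)).symm
    simpa using this
  have h3 := ((h1.add h2).const_mul (Real.pi ^ β))
  rw [intervalIntegrable_iff_integrableOn_Ioo_of_le (by positivity)] at h3
  refine Integrable.mono' h3 ?_ ?_
  · apply Measurable.aestronglyMeasurable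
    fun_prop
  · filter_upwards [ae_restrict_mem measurableSet_Ioo] with k hk
    have hk1 : 0 < k := hk.1
    have hk2 : 0 < 2 * Real.pi - k := by linarith [hk.2]
    have hm : 0 < min k (2 * Real.pi - k) := lt_min hk1 hk2
    rw [Real.norm_of_nonneg (by positivity), Real.div_rpow hm.le hpi.le, Real.rpow_neg hpi.le,
      div_inv_eq_mul, mul_comm]
    apply mul_le_mul_of_nonneg_left _ (by positivity)
    have e1 : 0 ≤ k ^ (-β) := by positivity
    have e2 : 0 ≤ (2 * Real.pi - k) ^ (-β) := by positivity
    rcases min_choice k (2 * Real.pi - k) with h | h <;> rw [h] <;> linarith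

lemma box_integrable {d : ℕ} (hd : 0 < d) {α : ℝ} (hα : α ∈ Set.Ioo (0 : ℝ) (d : ℝ)) :
    IntegrableOn (fun k : Fin d → ℝ => muk d k ^ (-(α / 2))) (box d) := by
  have hd' : (0:ℝ) < d := by exact_mod_cast hd
  have hpi := Real.pi_pos
  have hae : (box d : Set (Fin d → ℝ)) =ᵐ[volume]
      Set.univ.pi fun _ : Fin d => Set.Ioo (0:ℝ) (2 * Real.pi) := by
    exact (Measure.pi_Ioo_ae_eq_pi_Icc (μ := fun _ : Fin d => (volume : Measure ℝ))
      (s := Set.univ) (f := fun _ => 0) (g := fun _ => 2 * Real.pi)).symm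
  rw [integrableOn_congr_set_ae hae, IntegrableOn]
  have hI : Integrable (fun k : Fin d → ℝ => ∏ j, (min (k j) (2 * Real.pi - k j) / Real.pi) ^ (-(α/d)))
      (Measure.pi fun _ : Fin d => (volume : Measure ℝ).restrict (Set.Ioo (0:ℝ) (2 * Real.pi))) :=
    Integrable.fintype_prod (fun _ => one_dim_integrable (div_pos hα.1 hd')
      ((div_lt_one hd').2 hα.2))
  rw [← Measure.restrict_pi_pi, ← volume_pi] at hI
  refine Integrable.mono' hI ?_ ?_
  · apply Measurable.aestronglyMeasurable
    unfold muk
    fun_prop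
  · filter_upwards [ae_restrict_mem (MeasurableSet.univ_pi fun _ => measurableSet_Ioo)] with k hk
    have hk' : ∀ j, k j ∈ Set.Ioo (0:ℝ) (2 * Real.pi) := fun j => hk j (Set.mem_univ j)
    have hmu : muk d k = ∑ j, 4 * Real.sin (k j / 2) ^ 2 := by
      unfold muk
      have : ∀ j, 4 * Real.sin (k j / 2) ^ 2 = 2 - 2 * Real.cos (k j) := by
        intro j
        have h1 := Real.cos_sq (k j / 2)
        have h2 := Real.sin_sq_add_cos_sq (k j / 2)
        rw [show 2 * (k j / 2) = k j by ring] at h1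
        linarith
      simp_rw [this]
      rw [Finset.sum_sub_distrib, ← Finset.mul_sum]
      simp; ring
    have hlow : ∀ j, (min (k j) (2 * Real.pi - k j) / Real.pi) ^ 2 ≤ muk d k := by
      intro j
      obtain ⟨a, b⟩ := sin_half_lower (hk' j)
      rw [hmu]
      calc _ ≤ Real.sin (k j / 2) ^ 2 := by gcongr
        _ ≤ 4 * Real.sin (k j / 2) ^ 2 := by nlinarith [sq_nonneg (Real.sin (k j / 2))]
        _ ≤ _ := Finset.single_le_sum (f := fun j => 4 * Real.sin (k j / 2) ^ 2)
            (fun i _ => by positivity) (Finset.mem_univ j)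
    have hpos : 0 < muk d k :=
      lt_of_lt_of_le (pow_pos (sin_half_lower (hk' ⟨0, hd⟩)).1 2) (hlow ⟨0, hd⟩)
    rw [Real.norm_of_nonneg (by positivity)]
    calc muk d k ^ (-(α/2)) = ∏ _j : Fin d, muk d k ^ (-(α/2) / d) := by
          rw [Finset.prod_const, Finset.card_univ, Fintype.card_fin, ← Real.rpow_natCast,
            ← Real.rpow_mul hpos.le]
          congr 1; field_simp
      _ ≤ _ := by
          apply Finset.prod_le_prod
          · intro j _; positivity
          · intro j _
            have hm := (sin_half_lower (hk' j)).1
            have : (min (k j) (2 * Real.pi - k j) / Real.pi) ^ (-(α/d)) =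
                ((min (k j) (2 * Real.pi - k j) / Real.pi) ^ 2) ^ (-(α/2) / d) := by
              rw [← Real.rpow_natCast, ← Real.rpow_mul hm.le]
              congr 1; push_cast; field_simp
            rw [this]
            apply Real.rpow_le_rpow_of_nonpos (by positivity) (hlow j)
            have := hα.1
            rw [neg_div]
            have : 0 < α / 2 / d := by positivity
            linarith

lemma Riesz_bounded {d : ℕ} (hd : 0 < d) {α : ℝ} (hα : α ∈ Set.Ioo (0 : ℝ) (d : ℝ)) :
    ∃ M : ℝ, 0 ≤ M ∧ ∀ x y : Z d, |Riesz d α x y| ≤ M := by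
  refine ⟨|Kfrac d α * (2 * Real.pi) ^ (-(d : ℝ))| * ∫ k in box d, ‖muk d k ^ (-(α / 2))‖,
    by positivity, ?_⟩
  intro x y
  unfold Riesz
  rw [abs_mul]
  apply mul_le_mul_of_nonneg_left _ (abs_nonneg _)
  rw [← Real.norm_eq_abs]
  apply norm_integral_le_of_norm_le (box_integrable hd hα).norm
  filter_upwards with k
  rw [norm_mul]
  exact mul_le_of_le_one_left (norm_nonneg _) (Real.abs_cos_le_one _)

lemma f_bound {f : ℝ → ℝ} (hfc : Continuous f) (hfz : ∀ t ≤ (0 : ℝ), f t = 0) {p : ℝ}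
    (hp : 2 ≤ p) (hf1 : F1 f p) (M : ℝ) :
    ∃ C : ℝ, 0 ≤ C ∧ ∀ t, 0 ≤ t → t ≤ M → |f t| ≤ C * t ^ (p - 1) := by
  obtain ⟨δ, hδ, h1⟩ := hf1 1 one_pos
  obtain ⟨S, hS⟩ := (isCompact_Icc (a := (0:ℝ)) (b := M)).exists_bound_of_continuousOn
    hfc.continuousOn
  refine ⟨1 + |S| / δ ^ (p - 1), by positivity, ?_⟩
  intro t h0 hM
  have hq : 0 ≤ t ^ (p - 1) := by positivity
  have hr : 0 ≤ |S| / δ ^ (p - 1) := by positivity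
  rcases h0.eq_or_lt with h | h
  · subst h
    rw [hfz 0 le_rfl, abs_zero]; positivity
  rcases lt_or_ge t δ with h' | h'
  · have := h1 t h h'
    nlinarith [mul_nonneg hr hq]
  · have a1 : |f t| ≤ |S| := (hS t ⟨h0, hM⟩).trans (le_abs_self S)
    have a2 : δ ^ (p - 1) ≤ t ^ (p - 1) := Real.rpow_le_rpow hδ.le h' (by linarith)
    have a3 : |S| ≤ |S| / δ ^ (p - 1) * t ^ (p - 1) := by
      rw [div_mul_eq_mul_div, le_div_iff₀ (by positivity)]
      gcongr
    nlinarith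

lemma ft_bound {f : ℝ → ℝ} {p : ℝ} (hp : 2 ≤ p) {C t : ℝ} (ht : 0 ≤ t)
    (h : |f t| ≤ C * t ^ (p - 1)) : |f t * t| ≤ C * t ^ p := by
  rw [abs_mul, abs_of_nonneg ht]
  calc |f t| * t ≤ C * t ^ (p - 1) * t := by gcongr
    _ = C * t ^ p := by
      rw [mul_assoc, ← Real.rpow_add_one' ht (by linarith)]; congr 2; ring

lemma Fint_bound {f : ℝ → ℝ} {p : ℝ} (hp : 2 ≤ p) {C M : ℝ} (hC : 0 ≤ C)
    (h : ∀ t, 0 ≤ t → t ≤ M → |f t| ≤ C * t ^ (p - 1)) {t : ℝ} (ht : 0 ≤ t) (htM : t ≤ M) :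
    |Fint f t| ≤ C * t ^ p := by
  unfold Fint
  have := intervalIntegral.norm_integral_le_of_norm_le_const (a := 0) (b := t) (f := f)
    (C := C * t ^ (p - 1)) (fun r hr => by
      rw [Set.uIoc_of_le ht] at hr
      refine (h r hr.1.le (hr.2.trans htM)).trans ?_
      have := Real.rpow_le_rpow hr.1.le hr.2 (show 0 ≤ p - 1 by linarith)
      gcongr)
  rw [sub_zero, abs_of_nonneg ht, mul_assoc, ← Real.rpow_add_one' ht (by linarith)] at this
  simpa using this

lemma Fint_continuous {f : ℝ → ℝ} (hfc : Continuous f) : Continuous (Fint f) :=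
  intervalIntegral.continuous_primitive (fun a b => hfc.intervalIntegrable a b) 0

lemma summable_prod_bound {X : Type*} {R : X → X → ℝ} {M : ℝ} (hR : ∀ x y, |R x y| ≤ M)
    {a b : X → ℝ} (ha : Summable fun x => |a x|) (hb : Summable fun x => |b x|) :
    Summable fun q : X × X => R q.1 q.2 * a q.2 * b q.1 := by
  have h := (hb.mul_of_nonneg ha (fun _ => abs_nonneg _) (fun _ => abs_nonneg _)).mul_left M
  refine Summable.of_norm_bounded h ?_
  intro q
  rw [Real.norm_eq_abs, abs_mul, abs_mul]
  have := mul_le_mul_of_nonneg_right (hR q.1 q.2)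
    (mul_nonneg (abs_nonneg (b q.1)) (abs_nonneg (a q.2)))
  nlinarith

lemma tight_tendsto {X : Type*} {h : X → ℝ} {h₀ : ℝ} (hh₀ : 0 < h₀) (hh1 : ∀ x, h₀ ≤ h x)
    (hh2 : Tendsto h cofinite atTop) {e : ℕ → X → ℝ} (he : ∀ n x, 0 ≤ e n x)
    (hs : ∀ n, Summable fun x => h x * e n x) {D : ℝ} (hD : ∀ n, ∑' x, h x * e n x ≤ D)
    (hlim : ∀ x, Tendsto (fun n => e n x) atTop (𝓝 0)) :
    Tendsto (fun n => ∑' x, e n x) atTop (𝓝 0) := by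
  classical
  have hse : ∀ n, Summable (e n) := by
    intro n
    refine Summable.of_nonneg_of_le (he n) (fun x => ?_) ((hs n).mul_left h₀⁻¹)
    rw [inv_mul_eq_div, le_div_iff₀ hh₀, mul_comm]
    exact mul_le_mul_of_nonneg_right (hh1 x) (he n x)
  rw [Metric.tendsto_atTop]
  intro ε hε
  set η := ε / (2 * (|D| + 1)) with hη
  have hη0 : 0 < η := by positivity
  have hfin : {x | ¬ (1 / η ≤ h x)}.Finite := hh2.eventually_ge_atTop (1 / η)
  set S := hfin.toFinset
  have hS : Tendsto (fun n => ∑ x ∈ S, e n x) atTop (𝓝 0) := by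
    simpa using tendsto_finsetSum S (fun x _ => hlim x)
  obtain ⟨N, hN⟩ := Metric.tendsto_atTop.1 hS (ε / 2) (by positivity)
  refine ⟨N, fun n hn => ?_⟩
  have h1 := hN n hn
  rw [Real.dist_eq, sub_zero, abs_of_nonneg (Finset.sum_nonneg fun x _ => he n x)] at h1
  rw [Real.dist_eq, sub_zero, abs_of_nonneg (tsum_nonneg (he n))]
  have h2 : ∑' x, e n x ≤ ∑ x ∈ S, e n x + η * ∑' x, h x * e n x := by
    rw [← (hse n).sum_add_tsum_subtype_compl S]
    gcongr
    calc _ ≤ ∑' x : {x // x ∉ S}, η * (h x * e n x) := by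
          refine Summable.tsum_le_tsum (fun x => ?_) ((hse n).subtype _)
            (((hs n).mul_left η).subtype _)
          have hx : 1 / η ≤ h x := by
            have := x.2
            simp only [S, Set.Finite.mem_toFinset, Set.mem_ofPred_eq, not_not] at this
            exact this
          have : 1 ≤ η * h x := by
            rw [div_le_iff₀ hη0] at hx; linarith
          nlinarith [he n x]
      _ ≤ ∑' x, η * (h x * e n x) := by
          refine ((hs n).mul_left η).tsum_subtype_le _ _ (fun x => ?_)
          have := he n x
          have := hh1 x
          have : 0 ≤ h x := by linarith
          positivity
      _ = _ := tsum_mul_left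
  have h3 : η * ∑' x, h x * e n x ≤ ε / 2 := by
    calc _ ≤ η * (|D| + 1) := by
          gcongr; linarith [hD n, le_abs_self D]
      _ = ε / 2 := by rw [hη]; field_simp
  linarith

lemma bilin_tendsto {X : Type*} {R : X → X → ℝ} {M : ℝ} (hM : 0 ≤ M) (hR : ∀ x y, |R x y| ≤ M)
    {a b : ℕ → X → ℝ} {a' b' : X → ℝ} (ha : ∀ n, Summable fun x => |a n x|)
    (hb : ∀ n, Summable fun x => |b n x|) (ha' : Summable fun x => |a' x|)
    (hb' : Summable fun x => |b' x|)
    (hla : Tendsto (fun n => ∑' x, |a n x - a' x|) atTop (𝓝 0))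
    (hlb : Tendsto (fun n => ∑' x, |b n x - b' x|) atTop (𝓝 0)) :
    Tendsto (fun n => ∑' x, (∑' y, R x y * a n y) * b n x) atTop
      (𝓝 (∑' x, (∑' y, R x y * a' y) * b' x)) := by
  have key : ∀ c : X → ℝ, (Summable fun x => |c x|) → ∀ x, (Summable fun y => R x y * c y) ∧
      |∑' y, R x y * c y| ≤ M * ∑' y, |c y| := by
    intro c hc x
    have hb : ∀ y, ‖R x y * c y‖ ≤ M * |c y| := fun y => by
      rw [norm_mul]; exact mul_le_mul_of_nonneg_right (hR x y) (abs_nonneg _)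
    refine ⟨Summable.of_norm_bounded (hc.mul_left M) hb, ?_⟩
    rw [← tsum_mul_left]
    exact tsum_of_norm_bounded (hc.mul_left M).hasSum hb
  have key2 : ∀ c e : X → ℝ, (Summable fun x => |c x|) → (Summable fun x => |e x|) →
      (Summable fun x => (∑' y, R x y * c y) * e x) ∧
      |∑' x, (∑' y, R x y * c y) * e x| ≤ M * (∑' y, |c y|) * ∑' x, |e x| := by
    intro c e hc he
    have hb : ∀ x, ‖(∑' y, R x y * c y) * e x‖ ≤ (M * ∑' y, |c y|) * |e x| := fun x => by
      rw [norm_mul]; exact mul_le_mul_of_nonneg_right (key c hc x).2 (abs_nonneg _)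
    refine ⟨Summable.of_norm_bounded (he.mul_left _) hb, ?_⟩
    rw [← tsum_mul_left (f := fun x => |e x|)]
    exact tsum_of_norm_bounded (he.mul_left _).hasSum hb
  have hda : ∀ n, Summable fun x => |a n x - a' x| := fun n =>
    ((ha n).of_abs.sub ha'.of_abs).abs
  have hdb : ∀ n, Summable fun x => |b n x - b' x| := fun n =>
    ((hb n).of_abs.sub hb'.of_abs).abs
  rw [tendsto_iff_dist_tendsto_zero]
  have hlim : Tendsto (fun n => M * (∑' x, |a n x - a' x|) * ((∑' x, |b n x - b' x|) + ∑' x, |b' x|)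
      + M * (∑' x, |a' x|) * ∑' x, |b n x - b' x|) atTop (𝓝 0) := by
    have := ((hla.const_mul M).mul (hlb.add_const (∑' x, |b' x|))).add
      (hlb.const_mul (M * ∑' x, |a' x|))
    simpa using this
  refine squeeze_zero (fun _ => dist_nonneg) (fun n => ?_) hlim
  have e1 := key2 (fun x => a n x - a' x) (b n) (hda n) (hb n)
  have e2 := key2 a' (fun x => b n x - b' x) ha' (hdb n)
  have hbn : ∑' x, |b n x| ≤ (∑' x, |b n x - b' x|) + ∑' x, |b' x| := by
    rw [← (hdb n).tsum_add hb']
    refine (hb n).tsum_le_tsum (fun x => ?_) ((hdb n).add hb')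
    have := abs_add_le (b n x - b' x) (b' x)
    simpa using this
  have hdiff : (∑' x, (∑' y, R x y * a n y) * b n x) - ∑' x, (∑' y, R x y * a' y) * b' x
      = (∑' x, (∑' y, R x y * (a n y - a' y)) * b n x) +
        ∑' x, (∑' y, R x y * a' y) * (b n x - b' x) := by
    rw [← e1.1.tsum_add e2.1, ← (key2 _ _ (ha n) (hb n)).1.tsum_sub (key2 _ _ ha' hb').1]
    congr 1; ext x
    have : ∑' y, R x y * (a n y - a' y) = (∑' y, R x y * a n y) - ∑' y, R x y * a' y := by
      rw [← (key _ (ha n) x).1.tsum_sub (key _ ha' x).1]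
      congr 1; ext y; ring
    rw [this]; ring
  rw [Real.dist_eq, hdiff]
  refine (abs_add_le _ _).trans (add_le_add (e1.2.trans ?_) e2.2)
  have : 0 ≤ ∑' x, |a n x - a' x| := tsum_nonneg fun _ => abs_nonneg _
  gcongr

lemma fatou_mem {d : ℕ} {W : Z d → Z d → ℝ} {h : Z d → ℝ} {p D : ℝ} (hp : 2 ≤ p)
    (hW : ∀ x y, 0 < W x y) (hh : ∀ x, 0 ≤ h x) {w : ℕ → Z d → ℝ} {v : Z d → ℝ}
    (hmem : ∀ n, memH W h p (w n)) (hD : ∀ n, HnormP W h p (w n) ≤ D)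
    (hlim : ∀ x, Tendsto (fun n => w n x) atTop (𝓝 (v x))) :
    memH W h p v ∧ HnormP W h p v ≤ D := by
  have hp0 : (0:ℝ) < p := by linarith
  have hterm : ∀ (z : Z d → ℝ) x, 0 ≤ gradNorm W z x ^ p + h x * |z x| ^ p := fun z x =>
    add_nonneg (Real.rpow_nonneg (Real.sqrt_nonneg _) _)
      (mul_nonneg (hh x) (Real.rpow_nonneg (abs_nonneg _) _))
  have hsq : ∀ (z : Z d → ℝ) x y, 0 ≤ W x y * (z x - z y) ^ 2 := fun z x y =>
    mul_nonneg (hW x y).le (sq_nonneg _)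
  have hD0 : 0 ≤ D := (tsum_nonneg (hterm (w 0))).trans (hD 0)
  have hgrad : ∀ n x, gradNorm W (w n) x ≤ D ^ (1 / p) := by
    intro n x
    have h1 : gradNorm W (w n) x ^ p ≤ D := by
      have h2 := ((hmem n).2.le_tsum x (fun y _ => hterm (w n) y)).trans (hD n)
      have h3 : 0 ≤ h x * |w n x| ^ p :=
        mul_nonneg (hh x) (Real.rpow_nonneg (abs_nonneg _) _)
      linarith
    have := Real.rpow_le_rpow (Real.rpow_nonneg (Real.sqrt_nonneg _) _) h1
      (show 0 ≤ 1 / p by positivity)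
    rwa [← Real.rpow_mul (Real.sqrt_nonneg _), mul_one_div_cancel hp0.ne', Real.rpow_one] at this
  have hs1 : ∀ x, Summable fun y => W x y * (v x - v y) ^ 2 := by
    intro x
    refine summable_of_sum_le (c := 2 * (D ^ (1 / p)) ^ 2) (hsq v x) (fun T => ?_)
    have hl : Tendsto (fun n => ∑ y ∈ T, W x y * (w n x - w n y) ^ 2) atTop
        (𝓝 (∑ y ∈ T, W x y * (v x - v y) ^ 2)) :=
      tendsto_finsetSum T fun y _ => (((hlim x).sub (hlim y)).pow 2).const_mul _
    refine le_of_tendsto hl (Eventually.of_forall fun n => ?_)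
    have h1 := ((hmem n).1 x).sum_le_tsum T (fun y _ => hsq (w n) x y)
    have h2 := hgrad n x
    unfold gradNorm at h2
    rw [Real.sqrt_le_left (by positivity)] at h2
    linarith
  have hfin : ∀ S : Finset (Z d), ∑ x ∈ S, (gradNorm W v x ^ p + h x * |v x| ^ p) ≤ D := by
    intro S
    have hl : Tendsto (fun T : Finset (Z d) => ∑ x ∈ S,
        (Real.sqrt ((1 / 2) * ∑ y ∈ T, W x y * (v x - v y) ^ 2) ^ p + h x * |v x| ^ p)) atTop
        (𝓝 (∑ x ∈ S, (gradNorm W v x ^ p + h x * |v x| ^ p))) := by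
      refine tendsto_finsetSum S fun x _ => Tendsto.add_const _ ?_
      exact ((((hs1 x).hasSum : Tendsto _ _ _).const_mul (1/2)).sqrt).rpow_const (Or.inr hp0.le)
    refine le_of_tendsto hl (Eventually.of_forall fun T => ?_)
    have hl2 : Tendsto (fun n => ∑ x ∈ S,
        (Real.sqrt ((1 / 2) * ∑ y ∈ T, W x y * (w n x - w n y) ^ 2) ^ p + h x * |w n x| ^ p)) atTop
        (𝓝 (∑ x ∈ S,
        (Real.sqrt ((1 / 2) * ∑ y ∈ T, W x y * (v x - v y) ^ 2) ^ p + h x * |v x| ^ p))) := by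
      refine tendsto_finsetSum S fun x _ => Tendsto.add ?_ ?_
      · exact (((tendsto_finsetSum T fun y _ =>
          (((hlim x).sub (hlim y)).pow 2).const_mul _).const_mul (1/2)).sqrt).rpow_const
          (Or.inr hp0.le)
      · exact ((hlim x).abs.rpow_const (Or.inr hp0.le)).const_mul _
    refine le_of_tendsto hl2 (Eventually.of_forall fun n => ?_)
    calc _ ≤ ∑ x ∈ S, (gradNorm W (w n) x ^ p + h x * |w n x| ^ p) := by
          refine Finset.sum_le_sum fun x _ => ?_
          gcongr
          unfold gradNorm
          gcongr
          exact ((hmem n).1 x).sum_le_tsum T (fun y _ => hsq (w n) x y)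
      _ ≤ _ := (hmem n).2.sum_le_tsum S (fun x _ => hterm (w n) x)
      _ ≤ D := hD n
  have hs2 := summable_of_sum_le (hterm v) hfin
  exact ⟨⟨hs1, hs2⟩, hs2.tsum_le_of_sum_le hfin⟩

end Helpers

theorem choquard_terms_converge_along_subsequence
    {d : ℕ} (hd : 0 < d) {s p : ℝ} (hs : s ∈ Set.Ioo (0 : ℝ) 1) (hp : 2 ≤ p)
    {W : Z d → Z d → ℝ} (hW : KernelOK d s W)
    {α : ℝ} (hα : α ∈ Set.Ioo (0 : ℝ) (d : ℝ))
    {h : Z d → ℝ} {h₀ : ℝ} (hh₀ : 0 < h₀) (hh1 : ∀ x, h₀ ≤ h x)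
    (hh2 : H2 h)
    {f : ℝ → ℝ} (hfc : Continuous f) (hfz : ∀ t ≤ (0 : ℝ), f t = 0)
    (hf1 : F1 f p)
    {C₀ τ : ℝ} (hC₀ : 0 < C₀) (hτ : ((d : ℝ) + α) * p / (2 * d) < τ)
    (hf2 : ∀ t > (0 : ℝ), f t ≤ C₀ * (1 + t ^ (τ - 1)))
    {θ : ℝ} (hθ : p < θ) (hf3 : F3 f θ)
    (u : ℕ → Z d → ℝ) (hpos : ∀ n x, 0 ≤ u n x) (hmem : ∀ n, memH W h p (u n))
    {B : ℝ} (hB : ∀ n, normH W h p (u n) ≤ B) :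
    ∃ φ : ℕ → ℕ, StrictMono φ ∧ ∃ v : Z d → ℝ, (∀ x, 0 ≤ v x) ∧ memH W h p v ∧
      (∀ k, Summable fun q : Z d × Z d =>
        Riesz d α q.1 q.2 * Fint f (u (φ k) q.2) * Fint f (u (φ k) q.1)) ∧
      (∀ k, Summable fun q : Z d × Z d =>
        Riesz d α q.1 q.2 * Fint f (u (φ k) q.2) * (f (u (φ k) q.1) * u (φ k) q.1)) ∧
      (Summable fun q : Z d × Z d =>
        Riesz d α q.1 q.2 * Fint f (v q.2) * Fint f (v q.1)) ∧
      (Summable fun q : Z d × Z d =>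
        Riesz d α q.1 q.2 * Fint f (v q.2) * (f (v q.1) * v q.1)) ∧
      Tendsto
        (fun k => ∑' x : Z d, conv d α (fun y => Fint f (u (φ k) y)) x * Fint f (u (φ k) x))
        atTop (nhds (∑' x : Z d, conv d α (fun y => Fint f (v y)) x * Fint f (v x))) ∧
      Tendsto
        (fun k =>
          ∑' x : Z d, conv d α (fun y => Fint f (u (φ k) y)) x * f (u (φ k) x) * u (φ k) x)
        atTop (nhds (∑' x : Z d, conv d α (fun y => Fint f (v y)) x * f (v x) * v x)) := by
  obtain ⟨-, hWpos, -⟩ := hW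
  have hp0 : (0:ℝ) < p := by linarith
  have hh : ∀ x, 0 ≤ h x := fun x => hh₀.le.trans (hh1 x)
  obtain ⟨K, hK0, hK⟩ := Riesz_bounded hd hα
  have hg0 : ∀ (z : Z d → ℝ) x, 0 ≤ gradNorm W z x ^ p := fun z x =>
    Real.rpow_nonneg (Real.sqrt_nonneg _) _
  have hu0 : ∀ (z : Z d → ℝ) x, 0 ≤ h x * |z x| ^ p := fun z x =>
    mul_nonneg (hh x) (Real.rpow_nonneg (abs_nonneg _) _)
  have hH0 : ∀ z : Z d → ℝ, 0 ≤ HnormP W h p z := fun z =>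
    tsum_nonneg fun x => add_nonneg (hg0 z x) (hu0 z x)
  set D : ℝ := B ^ p with hDdef
  have hD : ∀ n, HnormP W h p (u n) ≤ D := by
    intro n
    have := Real.rpow_le_rpow (Real.rpow_nonneg (hH0 (u n)) _) (hB n) hp0.le
    rwa [← Real.rpow_mul (hH0 _), one_div_mul_cancel hp0.ne', Real.rpow_one] at this
  -- weighted `ℓ^p` bounds
  have hweight : ∀ z : Z d → ℝ, memH W h p z → HnormP W h p z ≤ D →
      (Summable fun x => h x * |z x| ^ p) ∧ ∑' x, h x * |z x| ^ p ≤ D := by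
    intro z hz hzD
    have hs : Summable fun x => h x * |z x| ^ p :=
      Summable.of_nonneg_of_le (hu0 z) (fun x => by linarith [hg0 z x]) hz.2
    exact ⟨hs, (hs.tsum_le_tsum (fun x => by linarith [hg0 z x]) hz.2).trans hzD⟩
  set M : ℝ := (D / h₀) ^ (1 / p) with hMdef
  have hsup : ∀ z : Z d → ℝ, memH W h p z → HnormP W h p z ≤ D → ∀ x, |z x| ≤ M := by
    intro z hz hzD x
    obtain ⟨a, b⟩ := hweight z hz hzD
    have h1 := (a.le_tsum x fun y _ => hu0 z y).trans b
    have hq : 0 ≤ |z x| ^ p := Real.rpow_nonneg (abs_nonneg _) _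
    have h2 : |z x| ^ p ≤ D / h₀ := by
      rw [le_div_iff₀ hh₀]
      nlinarith [hh1 x]
    have := Real.rpow_le_rpow hq h2 (show 0 ≤ 1 / p by positivity)
    rwa [← Real.rpow_mul (abs_nonneg _), mul_one_div_cancel hp0.ne', Real.rpow_one] at this
  have huM : ∀ n, u n ∈ Set.univ.pi fun _ : Z d => Set.Icc (0:ℝ) M := fun n x _ =>
    ⟨hpos n x, (le_abs_self _).trans (hsup _ (hmem n) (hD n) x)⟩
  obtain ⟨v, hv, φ, hφ, hconv⟩ :=
    (isCompact_univ_pi fun _ : Z d => isCompact_Icc (a := (0:ℝ)) (b := M)).tendsto_subseq huM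
  have hlim : ∀ x, Tendsto (fun k => u (φ k) x) atTop (𝓝 (v x)) := fun x =>
    (tendsto_pi_nhds.1 hconv) x
  have hv0 : ∀ x, 0 ≤ v x := fun x => (hv x (Set.mem_univ x)).1
  obtain ⟨hvmem, hvD⟩ := fatou_mem hp hWpos hh (fun k => hmem (φ k)) (fun k => hD (φ k)) hlim
  obtain ⟨C, hC0, hC⟩ := f_bound hfc hfz hp hf1 M
  -- any `g` with `|g t| ≤ C t^p`
  have hgen : ∀ g : ℝ → ℝ, (∀ t, 0 ≤ t → t ≤ M → |g t| ≤ C * t ^ p) →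
      ∀ z : Z d → ℝ, (∀ x, 0 ≤ z x) → memH W h p z → HnormP W h p z ≤ D →
      (Summable fun x => |g (z x)|) ∧ (Summable fun x => h x * |g (z x)|) ∧
        ∑' x, h x * |g (z x)| ≤ C * D := by
    intro g hg z hz0 hz hzD
    obtain ⟨a, b⟩ := hweight z hz hzD
    have hb : ∀ x, h x * |g (z x)| ≤ C * (h x * |z x| ^ p) := fun x => by
      have h1 := hg (z x) (hz0 x) ((le_abs_self _).trans (hsup z hz hzD x))
      rw [abs_of_nonneg (hz0 x)]
      nlinarith [mul_le_mul_of_nonneg_left h1 (hh x)]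
    have hs : Summable fun x => h x * |g (z x)| :=
      Summable.of_nonneg_of_le (fun x => mul_nonneg (hh x) (abs_nonneg _)) hb (a.mul_left C)
    refine ⟨?_, hs, ?_⟩
    · refine Summable.of_nonneg_of_le (fun x => abs_nonneg _) (fun x => ?_) (hs.mul_left h₀⁻¹)
      rw [inv_mul_eq_div, le_div_iff₀ hh₀, mul_comm]
      exact mul_le_mul_of_nonneg_right (hh1 x) (abs_nonneg _)
    · refine (hs.tsum_le_tsum hb (a.mul_left C)).trans ?_
      rw [tsum_mul_left]
      gcongr
  have hgen2 : ∀ g : ℝ → ℝ, Continuous g → (∀ t, 0 ≤ t → t ≤ M → |g t| ≤ C * t ^ p) →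
      Tendsto (fun k => ∑' x, |g (u (φ k) x) - g (v x)|) atTop (𝓝 0) := by
    intro g hgc hg
    have hu' := fun k => hgen g hg (u (φ k)) (hpos _) (hmem _) (hD _)
    have hv' := hgen g hg v hv0 hvmem hvD
    have hb : ∀ k x, h x * |g (u (φ k) x) - g (v x)| ≤
        h x * |g (u (φ k) x)| + h x * |g (v x)| := fun k x => by
      rw [← mul_add]
      exact mul_le_mul_of_nonneg_left (abs_sub _ _) (hh x)
    have hs : ∀ k, Summable fun x => h x * |g (u (φ k) x) - g (v x)| := fun k =>
      Summable.of_nonneg_of_le (fun x => mul_nonneg (hh x) (abs_nonneg _)) (hb k)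
        ((hu' k).2.1.add hv'.2.1)
    refine tight_tendsto hh₀ hh1 hh2 (fun _ _ => abs_nonneg _) hs (D := C * D + C * D) ?_ ?_
    · intro k
      refine ((hs k).tsum_le_tsum (hb k) ((hu' k).2.1.add hv'.2.1)).trans ?_
      rw [(hu' k).2.1.tsum_add hv'.2.1]
      exact add_le_add (hu' k).2.2 hv'.2.2
    · intro x
      have := (((hgc.tendsto (v x)).comp (hlim x)).sub_const (g (v x))).abs
      simpa using this
  have hF : ∀ t, 0 ≤ t → t ≤ M → |Fint f t| ≤ C * t ^ p := fun t h0 h1 =>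
    Fint_bound hp hC0 hC h0 h1
  have hG : ∀ t, 0 ≤ t → t ≤ M → |(fun t => f t * t) t| ≤ C * t ^ p := fun t h0 h1 =>
    ft_bound hp h0 (hC t h0 h1)
  have sFu := fun k => (hgen _ hF (u (φ k)) (hpos _) (hmem _) (hD _)).1
  have sGu := fun k => (hgen _ hG (u (φ k)) (hpos _) (hmem _) (hD _)).1
  have sFv := (hgen _ hF v hv0 hvmem hvD).1
  have sGv := (hgen _ hG v hv0 hvmem hvD).1
  have tF := hgen2 _ (Fint_continuous hfc) hF
  have tG := hgen2 _ (hfc.mul continuous_id) hG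
  have P1 : ∀ k, Summable fun q : Z d × Z d =>
      Riesz d α q.1 q.2 * Fint f (u (φ k) q.2) * Fint f (u (φ k) q.1) := fun k =>
    summable_prod_bound (R := Riesz d α) (a := fun x => Fint f (u (φ k) x))
      (b := fun x => Fint f (u (φ k) x)) hK (sFu k) (sFu k)
  have P2 : ∀ k, Summable fun q : Z d × Z d =>
      Riesz d α q.1 q.2 * Fint f (u (φ k) q.2) * (f (u (φ k) q.1) * u (φ k) q.1) := fun k =>
    summable_prod_bound (R := Riesz d α) (a := fun x => Fint f (u (φ k) x))
      (b := fun x => f (u (φ k) x) * u (φ k) x) hK (sFu k) (sGu k)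
  have P3 : Summable fun q : Z d × Z d =>
      Riesz d α q.1 q.2 * Fint f (v q.2) * Fint f (v q.1) :=
    summable_prod_bound (R := Riesz d α) (a := fun x => Fint f (v x))
      (b := fun x => Fint f (v x)) hK sFv sFv
  have P4 : Summable fun q : Z d × Z d =>
      Riesz d α q.1 q.2 * Fint f (v q.2) * (f (v q.1) * v q.1) :=
    summable_prod_bound (R := Riesz d α) (a := fun x => Fint f (v x))
      (b := fun x => f (v x) * v x) hK sFv sGv
  refine ⟨φ, hφ, v, hv0, hvmem, P1, P2, P3, P4, ?_, ?_⟩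
  · exact bilin_tendsto (R := Riesz d α) (a := fun k x => Fint f (u (φ k) x))
      (b := fun k x => Fint f (u (φ k) x)) (a' := fun x => Fint f (v x))
      (b' := fun x => Fint f (v x)) hK0 hK sFu sFu sFv sFv tF tF
  · simp only [mul_assoc]
    exact bilin_tendsto (R := Riesz d α) (a := fun k x => Fint f (u (φ k) x))
      (b := fun k x => f (u (φ k) x) * u (φ k) x) (a' := fun x => Fint f (v x))
      (b' := fun x => f (v x) * v x) hK0 hK sFu sGu sFv sGv tF tG

end DiscreteChoquard
end
end

section
/- Assume (h1) and (f1)–(f3). Suppose u : ℤ^d → ℝ satisfies ‖u‖_{H_{s,p}} < ∞, u ≢ 0, and solves pointwise, with all series converging absolutely, (−Δ)_p^s u(x) + h(x)|u(x)|^{p−2}u(x) = (R_α∗F(u⁺))(x)·f(u⁺(x)) for every x ∈ ℤ^d, where u⁺ = max(u,0). Then u(x) > 0 for every x ∈ ℤ^d; in particular u is a strictly positive pointwise solution of (−Δ)_p^s u(x) + h(x)u(x)^{p−1} = (R_α∗F(u))(x)·f(u(x)) on ℤ^d. -/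
open MeasureTheory Filter Topology
open scoped ENNReal

noncomputable section

namespace DiscreteChoquard

variable {d : ℕ}

theorem nontrivial_solution_is_strictly_positive
    {d : ℕ} (hd : 0 < d) {s p : ℝ} (hs : s ∈ Set.Ioo (0 : ℝ) 1) (hp : 2 ≤ p)
    {W : Z d → Z d → ℝ} (hW : KernelOK d s W)
    {α : ℝ} (hα : α ∈ Set.Ioo (0 : ℝ) (d : ℝ))
    {h : Z d → ℝ} {h₀ : ℝ} (hh₀ : 0 < h₀) (hh1 : ∀ x, h₀ ≤ h x)
    {f : ℝ → ℝ} (hfc : Continuous f) (hfz : ∀ t ≤ (0 : ℝ), f t = 0)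
    (hf1 : F1 f p)
    {C₀ τ : ℝ} (hC₀ : 0 < C₀) (hτ : ((d : ℝ) + α) * p / (2 * d) < τ)
    (hf2 : ∀ t > (0 : ℝ), f t ≤ C₀ * (1 + t ^ (τ - 1)))
    {θ : ℝ} (hθ : p < θ) (hf3 : F3 f θ)
    (u : Z d → ℝ) (humem : memH W h p u) (hune : u ≠ 0)
    (hsol : ∀ x : Z d,
      (Summable fun y : Z d =>
        W x y * (gradNorm W u x ^ (p - 2) + gradNorm W u y ^ (p - 2)) * (u x - u y)) ∧
      (Summable fun y : Z d => Riesz d α x y * Fint f (pos u y)) ∧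
      pLap W p u x + h x * |u x| ^ (p - 2) * u x =
        conv d α (fun y => Fint f (pos u y)) x * f (pos u x)) :
    (∀ x, 0 < u x) ∧
      ∀ x : Z d,
        pLap W p u x + h x * u x ^ (p - 1) =
          conv d α (fun y => Fint f (u y)) x * f (u x) := by
  obtain ⟨hWs, hWp, -⟩ := hW
  obtain ⟨hsum1, hsum2⟩ := humem
  have hg : ∀ x, 0 ≤ gradNorm W u x := fun x => Real.sqrt_nonneg _
  have hp0 : 0 < p := by linarith
  -- nonnegativity via a pointwise minimum
  have hnn : ∀ z, 0 ≤ u z := by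
    intro z
    by_contra hz
    push Not at hz
    have hpos : 0 < h₀ * |u z| ^ p := by
      have : 0 < |u z| := abs_pos.mpr hz.ne
      positivity
    have hfin : {y : Z d | u y ≤ u z}.Finite := by
      have hev := hsum2.tendsto_cofinite_zero.eventually (gt_mem_nhds hpos)
      rw [Filter.eventually_cofinite] at hev
      refine hev.subset fun y hy => ?_
      have hy' : u y ≤ u z := hy
      have h1 : |u z| ≤ |u y| := by
        rw [abs_of_neg hz, abs_of_neg (by linarith)]; linarith
      have h2 : |u z| ^ p ≤ |u y| ^ p := Real.rpow_le_rpow (abs_nonneg _) h1 hp0.le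
      have h3 : h₀ * |u z| ^ p ≤ h y * |u y| ^ p :=
        mul_le_mul (hh1 y) h2 (by positivity) (hh₀.le.trans (hh1 y))
      have h4 : 0 ≤ gradNorm W u y ^ p := Real.rpow_nonneg (hg y) p
      simp only [Set.mem_setOf_eq, not_lt]
      linarith
    obtain ⟨x, hx, hmin⟩ := Set.exists_min_image _ u hfin ⟨z, le_refl (u z)⟩
    have hx' : u x ≤ u z := hx
    have hmin' : ∀ y, u x ≤ u y := by
      intro y
      by_cases hy : u y ≤ u z
      · exact hmin y hy
      · push Not at hy; linarith
    have hux : u x < 0 := by linarith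
    have heq := (hsol x).2.2
    have hpz : pos u x = 0 := max_eq_right hux.le
    rw [hpz, hfz 0 le_rfl, mul_zero] at heq
    have hL : pLap W p u x ≤ 0 := by
      unfold pLap
      have : ∑' y : Z d, W x y * (gradNorm W u x ^ (p - 2) + gradNorm W u y ^ (p - 2))
          * (u x - u y) ≤ 0 := by
        refine tsum_nonpos fun y => ?_
        have a1 := (hWp x y).le
        have a2 := Real.rpow_nonneg (hg x) (p - 2)
        have a3 := Real.rpow_nonneg (hg y) (p - 2)
        exact mul_nonpos_of_nonneg_of_nonpos (by positivity) (by linarith [hmin' y])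
      linarith
    have hneg : h x * |u x| ^ (p - 2) * u x < 0 := by
      have b1 : 0 < |u x| := abs_pos.mpr hux.ne
      have b2 : 0 < h x := hh₀.trans_le (hh1 x)
      exact mul_neg_of_pos_of_neg (by positivity) hux
    linarith
  have hpu : pos u = u := funext fun x => max_eq_left (hnn x)
  have hup : ∀ x, 0 < u x := by
    intro x
    refine lt_of_le_of_ne (hnn x) fun hx0 => ?_
    have hx : u x = 0 := hx0.symm
    obtain ⟨y, hy⟩ := Function.ne_iff.mp hune
    have huy : 0 < u y := lt_of_le_of_ne (hnn y) (Ne.symm hy)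
    have hgx : 0 < gradNorm W u x := by
      refine Real.sqrt_pos.mpr (mul_pos (by norm_num) ?_)
      refine (hsum1 x).tsum_pos (fun w => ?_) y ?_
      · have := (hWp x w).le
        positivity
      · have := hWp x y
        have h2 : u x - u y ≠ 0 := by rw [hx]; linarith
        positivity
    have hgxp := Real.rpow_pos_of_pos hgx (p - 2)
    obtain ⟨hs1, -, heq⟩ := hsol x
    rw [hpu, hx, hfz 0 le_rfl, mul_zero, mul_zero, add_zero] at heq
    have hL : 0 < ∑' w : Z d, -(W x w * (gradNorm W u x ^ (p - 2) + gradNorm W u w ^ (p - 2))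
          * (u x - u w)) := by
      refine hs1.neg.tsum_pos (fun w => ?_) y ?_
      · have a1 := (hWp x w).le
        have a3 := Real.rpow_nonneg (hg w) (p - 2)
        have a4 := hnn w
        rw [hx, zero_sub, mul_neg, neg_neg]
        positivity
      · have a1 := hWp x y
        have a3 := Real.rpow_nonneg (hg y) (p - 2)
        rw [hx, zero_sub, mul_neg, neg_neg]
        positivity
    rw [tsum_neg] at hL
    unfold pLap at heq
    linarith
  refine ⟨hup, fun x => ?_⟩
  have heq := (hsol x).2.2
  rw [hpu] at heq
  rw [← heq, abs_of_pos (hup x), mul_assoc, ← Real.rpow_add_one (hup x).ne']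
  congr 3
  ring

end DiscreteChoquard
end
end
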